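/- arXiv:0906.5402 — 2 statements merged into one kernel-verified Lean document; each statement's English description precedes it below -/
import Mathlib

section
/- (Theorem 3, third sequence.) Let ε > 0 and α_n = 1/(log(n+2) · (log log(n+3))^{1+ε}) for n ≥ 0. Then for every f ∈ H^∞, the function f*α belongs to 𝔑 (i.e. ‖f*α‖_{H^∞} + Λ(f*α) < ∞), and the Toeplitz operator T_{f*α} is bounded on H^1 and on H^∞. -/
open MeasureTheory Complex Metric Set
open scoped ENNReal

/-- Normalized Lebesgue (arc-length) measure on the unit circle `𝕋 ⊆ ℂ`. -/
noncomputable def circleMeasure : Measure ℂ :=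
  Measure.map (fun θ : ℝ => Complex.exp (θ * Complex.I))
    ((ENNReal.ofReal (2 * Real.pi))⁻¹ • volume.restrict (Set.Ioc 0 (2 * Real.pi)))

/-- `‖f‖_{H^p}^p = sup_{0<r<1} ∫_𝕋 |f(rζ)|^p dm(ζ)`, as a value in `[0,∞]`. -/
noncomputable def hardyNorm (p : ℝ) (f : ℂ → ℂ) : ℝ≥0∞ :=
  ⨆ r ∈ Set.Ioo (0 : ℝ) 1,
    ∫⁻ ζ, ENNReal.ofReal (‖f (↑r * ζ)‖ ^ p) ∂circleMeasure

/-- `‖f‖_{H^∞} = sup_{z ∈ 𝔻} |f(z)|`, as a value in `[0,∞]`. -/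
noncomputable def eSupAbs (f : ℂ → ℂ) : ℝ≥0∞ :=
  ⨆ z ∈ Metric.ball (0 : ℂ) 1, ENNReal.ofReal ‖f z‖

/-- `g` is the boundary function of `f` : radial limits a.e. on `𝕋`. -/
def IsBoundaryFn (f g : ℂ → ℂ) : Prop :=
  ∀ᵐ ζ ∂circleMeasure,
    Filter.Tendsto (fun r : ℝ => f (↑r * ζ)) (nhdsWithin 1 (Set.Iio 1)) (nhds (g ζ))

/-- `Λ(f) = ess sup_{η ∈ 𝕋} ∫_𝕋 |f*(ζ) - f*(η)|/|ζ - η| dm(ζ)` for a boundary function `f*`. -/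
noncomputable def Lam (g : ℂ → ℂ) : ℝ≥0∞ :=
  essSup (fun η =>
    ∫⁻ ζ, ENNReal.ofReal (‖g ζ - g η‖ / ‖ζ - η‖) ∂circleMeasure)
    circleMeasure

/-- Toeplitz operator: `(T_g h)(z) = ∫_𝕋 conj(g*(ζ)) h*(ζ)/(1 - conj(ζ) z) dm(ζ)`,
given boundary functions `gs = g*`, `hs = h*`. -/
noncomputable def toeplitz (gs hs : ℂ → ℂ) : ℂ → ℂ := fun z =>
  ∫ ζ, (starRingEnd ℂ) (gs ζ) * hs ζ / (1 - (starRingEnd ℂ) ζ * z) ∂circleMeasure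

/-- `f̂(n)`, the `n`-th Taylor coefficient of `f` at `0`. -/
noncomputable def taylorCoeff (f : ℂ → ℂ) (n : ℕ) : ℂ :=
  iteratedDeriv n f 0 / n.factorial

/-- `(f*α)(z) = ∑_{n≥0} f̂(n) α_n z^n`. -/
noncomputable def seqConv (f : ℂ → ℂ) (α : ℕ → ℝ) : ℂ → ℂ := fun z =>
  ∑' n : ℕ, taylorCoeff f n * (α n : ℂ) * z ^ n

/-- Partial sum `S_n(f)(z) = ∑_{k=0}^n f̂(k) z^k`. -/
noncomputable def taylorPartial (f : ℂ → ℂ) (n : ℕ) (z : ℂ) : ℂ :=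
  ∑ k ∈ Finset.range (n + 1), taylorCoeff f k * z ^ k

/-- Cesàro mean `σ_n(f)(z) = (1/(n+1)) ∑_{k=0}^n S_k(f)(z)`. -/
noncomputable def cesaro (f : ℂ → ℂ) (n : ℕ) (z : ℂ) : ℂ :=
  ((n : ℂ) + 1)⁻¹ * ∑ k ∈ Finset.range (n + 1), taylorPartial f k z



/-! ### Basic facts on the circle measure -/

lemma cm_meas_exp : Measurable (fun θ : ℝ => Complex.exp (θ * Complex.I)) := by fun_prop

lemma cm_lintegral (F : ℂ → ℝ≥0∞) (hF : Measurable F) :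
    ∫⁻ ζ, F ζ ∂circleMeasure = (ENNReal.ofReal (2 * Real.pi))⁻¹ *
      ∫⁻ θ in Set.Ioc 0 (2 * Real.pi), F (Complex.exp ((θ : ℝ) * Complex.I)) := by
  unfold circleMeasure
  rw [lintegral_map hF cm_meas_exp, lintegral_smul_measure, smul_eq_mul]

instance cm_prob : IsProbabilityMeasure circleMeasure := by
  constructor
  unfold circleMeasure
  rw [Measure.map_apply cm_meas_exp MeasurableSet.univ]
  simp only [preimage_univ, Measure.smul_apply, MeasurableSet.univ, Measure.restrict_apply,
    univ_inter, Real.volume_Ioc, sub_zero, smul_eq_mul]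
  refine ENNReal.inv_mul_cancel ?_ ENNReal.ofReal_ne_top
  simp [Real.pi_pos]

lemma cm_ae_norm : ∀ᵐ ζ ∂circleMeasure, ‖ζ‖ = 1 := by
  unfold circleMeasure
  rw [ae_map_iff cm_meas_exp.aemeasurable (by exact measurableSet_eq_fun measurable_norm measurable_const)]
  refine Filter.Eventually.of_forall (fun θ => ?_)
  exact Complex.norm_exp_ofReal_mul_I θ

lemma cm_restrict : circleMeasure.restrict (sphere (0:ℂ) 1) = circleMeasure := by
  apply Measure.restrict_eq_self_of_ae_mem
  filter_upwards [cm_ae_norm] with ζ h using by simpa using h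

lemma cm_aesm {E : Type*} [NormedAddCommGroup E] [SecondCountableTopology E]
    {F : ℂ → E} (hF : ContinuousOn F (sphere (0:ℂ) 1)) :
    AEStronglyMeasurable F circleMeasure := by
  rw [← cm_restrict]
  borelize E
  exact hF.aestronglyMeasurable (isClosed_sphere.measurableSet)

lemma cm_integrable {E : Type*} [NormedAddCommGroup E] [SecondCountableTopology E]
    {F : ℂ → E} (hF : ContinuousOn F (sphere (0:ℂ) 1)) :
    Integrable F circleMeasure := by
  rw [← cm_restrict]
  exact hF.integrableOn_compact (isCompact_sphere 0 1)

lemma cm_integral {E : Type*} [NormedAddCommGroup E] [SecondCountableTopology E]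
    [NormedSpace ℝ E]
    {F : ℂ → E} (hF : ContinuousOn F (sphere (0:ℂ) 1)) :
    ∫ ζ, F ζ ∂circleMeasure = Real.circleAverage F 0 1 := by
  have h := cm_aesm hF
  unfold circleMeasure at h ⊢
  rw [integral_map cm_meas_exp.aemeasurable h, integral_smul_measure, Real.circleAverage_def,
    intervalIntegral.integral_of_le (by positivity)]
  congr 1
  · simp [ENNReal.toReal_inv, Real.pi_pos.le]
  · simp [circleMap]

/-! ### The logarithmic kernel estimate -/

noncomputable def logKer (δ : ℝ) (ζ η : ℂ) : ℝ := 1 / (δ + ‖ζ - η‖)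

lemma logKer_nonneg {δ : ℝ} (hδ : 0 < δ) (ζ η : ℂ) : 0 ≤ logKer δ ζ η := by
  unfold logKer; positivity

lemma logKer_comm (δ : ℝ) (ζ η : ℂ) : logKer δ ζ η = logKer δ η ζ := by
  unfold logKer; rw [norm_sub_rev]

lemma logKer_cont {δ : ℝ} (hδ : 0 < δ) : Continuous (fun p : ℂ × ℂ => logKer δ p.1 p.2) := by
  unfold logKer
  refine Continuous.div (by fun_prop) (by fun_prop) (fun p => by positivity)

lemma logKer_half {δ : ℝ} (hδ : 0 < δ) :
    ∫ u in (0:ℝ)..Real.pi, 1 / (δ + 2 / Real.pi * u)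
      = Real.pi / 2 * Real.log (1 + 2 / δ) := by
  have hpi := Real.pi_pos
  have h : ∀ u ∈ Set.uIcc (0:ℝ) Real.pi, HasDerivAt
      (fun u => Real.pi / 2 * Real.log (δ + 2 / Real.pi * u)) (1 / (δ + 2 / Real.pi * u)) u := by
    intro u hu
    rw [Set.uIcc_of_le hpi.le] at hu
    have hpos : 0 < δ + 2 / Real.pi * u := by have := hu.1; positivity
    have h1 : HasDerivAt (fun u : ℝ => δ + 2 / Real.pi * u) (2 / Real.pi) u := by
      simpa using ((hasDerivAt_id u).const_mul (2 / Real.pi)).const_add δ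
    have h2 := (h1.log hpos.ne').const_mul (Real.pi / 2)
    have h3 : Real.pi / 2 * (2 / Real.pi / (δ + 2 / Real.pi * u)) = 1 / (δ + 2 / Real.pi * u) := by
      rw [← mul_div_assoc]; congr 1; field_simp
    rw [h3] at h2
    exact h2
  rw [intervalIntegral.integral_eq_sub_of_hasDerivAt h]
  · have : δ + 2 / Real.pi * Real.pi = δ * (1 + 2 / δ) := by field_simp
    rw [this, Real.log_mul hδ.ne' (by positivity)]
    simp; ring
  · apply ContinuousOn.intervalIntegrable
    refine ContinuousOn.div (by fun_prop) (by fun_prop) ?_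
    intro u hu
    rw [Set.uIcc_of_le hpi.le] at hu
    have := hu.1
    positivity

lemma logKer_integral {δ : ℝ} (hδ : 0 < δ) {η : ℂ} (hη : ‖η‖ = 1) :
    ∫ ζ, logKer δ ζ η ∂circleMeasure ≤ 1 / 2 * Real.log (1 + 2 / δ) := by
  have hpi := Real.pi_pos
  have hc : Continuous (fun ζ : ℂ => logKer δ ζ η) :=
    (logKer_cont hδ).comp (by fun_prop : Continuous fun ζ : ℂ => (ζ, η))
  rw [cm_integral hc.continuousOn, Real.circleAverage_eq_integral_add (Complex.arg η)]
  set G : ℝ → ℝ := fun θ => logKer δ (circleMap 0 1 (θ + Complex.arg η)) η with hG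
  have hGc : Continuous G := hc.comp (by fun_prop)
  have hper : Function.Periodic G (2 * Real.pi) := by
    intro θ
    simp only [hG]
    rw [show θ + 2 * Real.pi + η.arg = (θ + η.arg) + 2 * Real.pi by ring,
      periodic_circleMap 0 1 (θ + η.arg)]
  have h1 : ∫ θ in (0:ℝ)..2 * Real.pi, G θ = ∫ θ in (-Real.pi)..Real.pi, G θ := by
    have := hper.intervalIntegral_add_eq 0 (-Real.pi)
    rw [zero_add] at this
    rw [this]; congr 1; ring
  have hη' : η = Complex.exp (Complex.arg η * I) := by
    have := Complex.norm_mul_exp_arg_mul_I η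
    rw [hη] at this; simpa using this.symm
  have key : ∀ u : ℝ, |u| ≤ Real.pi → G u ≤ 1 / (δ + 2 / Real.pi * |u|) := by
    intro u hu
    have e : circleMap 0 1 (u + Complex.arg η) - η
        = (Complex.exp (I * u) - 1) * Complex.exp (Complex.arg η * I) := by
      simp only [circleMap]
      conv_lhs => rw [hη']
      push_cast
      rw [add_mul, Complex.exp_add, mul_comm (u:ℂ) I]
      simp only [← hη']
      ring
    have en : ‖circleMap 0 1 (u + Complex.arg η) - η‖ = 2 * |Real.sin (u / 2)| := by
      rw [e, norm_mul, Complex.norm_exp_ofReal_mul_I, mul_one,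
        Complex.norm_exp_I_mul_ofReal_sub_one]
      simp
    simp only [hG, logKer]
    rw [en]
    have hs := Real.mul_abs_le_abs_sin (x := u / 2) (by rw [abs_div]; simp; linarith)
    rw [abs_div, abs_two] at hs
    apply one_div_le_one_div_of_le (by positivity)
    have : 2 / Real.pi * |u| = 2 * (2 / Real.pi * (|u| / 2)) := by ring
    linarith
  have hIntg : ∀ a b : ℝ, IntervalIntegrable G volume a b := fun a b => hGc.intervalIntegrable a b
  have hb : Continuous (fun u : ℝ => 1 / (δ + 2 / Real.pi * |u|)) := by
    refine Continuous.div (by fun_prop) (by fun_prop) (fun u => by positivity)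
  have h2 : ∫ θ in (-Real.pi)..Real.pi, G θ
      ≤ ∫ u in (-Real.pi)..Real.pi, 1 / (δ + 2 / Real.pi * |u|) := by
    apply intervalIntegral.integral_mono_on (by linarith) (hIntg _ _) (hb.intervalIntegrable _ _)
    intro u hu
    exact key u (abs_le.2 hu)
  have h3 : ∫ u in (-Real.pi)..Real.pi, 1 / (δ + 2 / Real.pi * |u|)
      = Real.pi * Real.log (1 + 2 / δ) := by
    rw [← intervalIntegral.integral_add_adjacent_intervals (b := 0)
      (hb.intervalIntegrable _ _) (hb.intervalIntegrable _ _)]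
    have a1 : ∫ u in (0:ℝ)..Real.pi, 1 / (δ + 2 / Real.pi * |u|)
        = Real.pi / 2 * Real.log (1 + 2 / δ) := by
      rw [← logKer_half hδ]
      apply intervalIntegral.integral_congr
      intro u hu
      rw [Set.uIcc_of_le hpi.le] at hu
      simp only [abs_of_nonneg hu.1]
    have a2 : ∫ u in (-Real.pi)..0, 1 / (δ + 2 / Real.pi * |u|)
        = ∫ u in (0:ℝ)..Real.pi, 1 / (δ + 2 / Real.pi * |u|) := by
      have := intervalIntegral.integral_comp_neg
        (a := 0) (b := Real.pi) (fun u : ℝ => 1 / (δ + 2 / Real.pi * |u|))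
      simp only [abs_neg, neg_zero] at this
      exact this.symm
    rw [a2, a1]; ring
  rw [h1, smul_eq_mul]
  calc (2 * Real.pi)⁻¹ * ∫ θ in (-Real.pi)..Real.pi, G θ
      ≤ (2 * Real.pi)⁻¹ * (Real.pi * Real.log (1 + 2 / δ)) := by
        rw [← h3]; gcongr
    _ = 1 / 2 * Real.log (1 + 2 / δ) := by field_simp

/-- scale used for the `n`-th Cesàro mean -/
noncomputable def dl (n : ℕ) : ℝ := 1 / ((n : ℝ) + 1) ^ 2

lemma dl_pos (n : ℕ) : 0 < dl n := by unfold dl; positivity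

lemma logKer_lintegral (n : ℕ) {η : ℂ} (hη : ‖η‖ = 1) :
    ∫⁻ ζ, ENNReal.ofReal (logKer (dl n) ζ η) ∂circleMeasure
      ≤ ENNReal.ofReal (2 * Real.log ((n : ℝ) + 2)) := by
  have hc : Continuous (fun ζ : ℂ => logKer (dl n) ζ η) :=
    (logKer_cont (dl_pos n)).comp (by fun_prop : Continuous fun ζ : ℂ => (ζ, η))
  rw [← ofReal_integral_eq_lintegral_ofReal (cm_integrable hc.continuousOn)
    (Filter.Eventually.of_forall fun ζ => logKer_nonneg (dl_pos n) ζ η)]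
  apply ENNReal.ofReal_le_ofReal
  refine (logKer_integral (dl_pos n) hη).trans ?_
  have h : 1 + 2 / dl n ≤ ((n : ℝ) + 2) ^ 4 := by
    unfold dl
    have : (0:ℝ) ≤ n := Nat.cast_nonneg n
    simp only [div_div_eq_mul_div, div_one]
    nlinarith [pow_nonneg this 2, pow_nonneg this 3, pow_nonneg this 4]
  have hp := dl_pos n
  have := Real.log_le_log (by positivity) h
  rw [Real.log_pow] at this
  push_cast at this
  linarith


/-! ### Taylor coefficients and the Fejér bound -/

section fejer

lemma norm_taylorCoeff_le {f : ℂ → ℂ} (hf : DifferentiableOn ℂ f (ball (0:ℂ) 1)) {M : ℝ}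
    (hM : ∀ z ∈ ball (0:ℂ) 1, ‖f z‖ ≤ M) (n : ℕ) : ‖taylorCoeff f n‖ ≤ M := by
  have h1 : ∀ R ∈ Ioo (0:ℝ) 1, ‖taylorCoeff f n‖ * R ^ n ≤ M := by
    intro R hR
    have hsub : closedBall (0:ℂ) R ⊆ ball (0:ℂ) 1 := closedBall_subset_ball hR.2
    have := Complex.norm_iteratedDeriv_le_of_forall_mem_sphere_norm_le (c := 0) (R := R) (C := M)
      (f := f) n hR.1 (DifferentiableOn.diffContOnCl (by
        rw [closure_ball _ hR.1.ne']; exact hf.mono hsub))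
      (fun z hz => hM z (hsub (sphere_subset_closedBall hz)))
    unfold taylorCoeff
    rw [norm_div, Complex.norm_natCast]
    have hR' : 0 < R ^ n := pow_pos hR.1 n
    have hn : (0:ℝ) < n.factorial := by positivity
    rw [div_mul_eq_mul_div, div_le_iff₀ hn]
    rw [le_div_iff₀ hR'] at this
    linarith
  have h2 : Filter.Tendsto (fun R : ℝ => ‖taylorCoeff f n‖ * R ^ n) (nhdsWithin 1 (Iio 1))
      (nhds (‖taylorCoeff f n‖ * 1 ^ n)) := by
    apply Filter.Tendsto.mono_left _ nhdsWithin_le_nhds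
    exact (by fun_prop : Continuous fun R : ℝ => ‖taylorCoeff f n‖ * R ^ n).tendsto 1
  have h3 := le_of_tendsto h2 (b := M) (by
    filter_upwards [Ioo_mem_nhdsLT (show (0:ℝ) < 1 by norm_num)] with R hR using h1 R hR)
  simpa using h3

lemma hasSum_taylorCoeff {f : ℂ → ℂ} (hf : DifferentiableOn ℂ f (ball (0:ℂ) 1)) {z : ℂ}
    (hz : z ∈ ball (0:ℂ) 1) : HasSum (fun n => taylorCoeff f n * z ^ n) (f z) := by
  have := Complex.hasSum_taylorSeries_on_ball hf hz
  refine this.congr_fun ?_ |> id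
  intro n
  simp only [taylorCoeff, sub_zero, smul_eq_mul]
  ring

lemma cm_orth (l : ℕ) (j k : ℕ) :
    ∫ ζ, ζ ^ l * ((starRingEnd ℂ) ζ ^ j * ζ ^ k) ∂circleMeasure = if l + k = j then 1 else 0 := by
  have hcont : ContinuousOn (fun ζ : ℂ => ζ ^ l * ((starRingEnd ℂ) ζ ^ j * ζ ^ k)) (sphere (0:ℂ) 1) := by
    have : Continuous (fun ζ : ℂ => (starRingEnd ℂ) ζ) := Complex.continuous_conj
    fun_prop
  rw [cm_integral hcont, Real.circleAverage_def]
  have e : ∀ θ : ℝ, (circleMap 0 1 θ) ^ l * ((starRingEnd ℂ) (circleMap 0 1 θ) ^ j * (circleMap 0 1 θ) ^ k)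
      = Complex.exp ((((l + k : ℤ) - j : ℤ) * I) * θ) := by
    intro θ
    simp only [circleMap, zero_add, ofReal_one, one_mul, ← Complex.exp_conj, map_mul, conj_ofReal,
      conj_I, ← Complex.exp_nat_mul, ← Complex.exp_add]
    congr 1
    push_cast; ring
  simp_rw [e]
  split_ifs with h
  · have : ((l + k : ℤ) - j : ℤ) = 0 := by omega
    rw [this]
    have hpi : (Real.pi : ℂ) ≠ 0 := by exact_mod_cast Real.pi_ne_zero
    simp
    field_simp
  · have hne : ((l + k : ℤ) - j : ℤ) ≠ 0 := by omega
    set m : ℤ := ((l + k : ℤ) - j : ℤ)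
    have hc : (m : ℂ) * I ≠ 0 := mul_ne_zero (by exact_mod_cast hne) I_ne_zero
    rw [integral_exp_mul_complex hc]
    have : Complex.exp ((m : ℂ) * I * ((2 * Real.pi : ℝ) : ℂ)) = 1 := by
      rw [Complex.exp_eq_one_iff]
      exact ⟨m, by push_cast; ring⟩
    rw [this]; simp

lemma moment {f : ℂ → ℂ} (hf : DifferentiableOn ℂ f (ball (0:ℂ) 1)) {M : ℝ}
    (hM : ∀ z ∈ ball (0:ℂ) 1, ‖f z‖ ≤ M) {r : ℝ} (h0 : 0 ≤ r) (h1 : r < 1) (j k : ℕ) :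
    ∫ ζ, f (r * ζ) * ((starRingEnd ℂ) ζ ^ j * ζ ^ k) ∂circleMeasure
      = if k ≤ j then taylorCoeff f (j - k) * (r:ℂ) ^ (j - k) else 0 := by
  have hconj : Continuous (fun ζ : ℂ => (starRingEnd ℂ) ζ) := Complex.continuous_conj
  set F : ℕ → ℂ → ℂ := fun l ζ => taylorCoeff f l * (r:ℂ) ^ l * (ζ ^ l * ((starRingEnd ℂ) ζ ^ j * ζ ^ k))
  have hFc : ∀ l, Continuous (F l) := fun l => by simp only [F]; fun_prop
  have hFi : ∀ l, Integrable (F l) circleMeasure := fun l => cm_integrable (hFc l).continuousOn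
  have hFn : ∀ l, ∀ᵐ ζ ∂circleMeasure, ‖F l ζ‖ ≤ M * r ^ l := by
    intro l
    filter_upwards [cm_ae_norm] with ζ hζ
    simp only [F, norm_mul, norm_pow, RCLike.norm_conj, hζ, one_pow, mul_one, norm_real,
      Real.norm_eq_abs, abs_of_nonneg h0]
    gcongr
    exact norm_taylorCoeff_le hf hM l
  have hs : Summable (fun l => ∫ ζ, ‖F l ζ‖ ∂circleMeasure) := by
    refine Summable.of_nonneg_of_le (fun l => integral_nonneg fun _ => norm_nonneg _)
      (fun l => ?_) ((summable_geometric_of_lt_one h0 h1).mul_left M)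
    calc ∫ ζ, ‖F l ζ‖ ∂circleMeasure ≤ ∫ ζ, M * r ^ l ∂circleMeasure :=
          integral_mono_ae (hFi l).norm (integrable_const _) (hFn l)
      _ = M * r ^ l := by simp
  have hS := hasSum_integral_of_summable_integral_norm hFi hs
  have e1 : ∫ ζ, (∑' l, F l ζ) ∂circleMeasure
      = ∫ ζ, f (r * ζ) * ((starRingEnd ℂ) ζ ^ j * ζ ^ k) ∂circleMeasure := by
    apply integral_congr_ae
    filter_upwards [cm_ae_norm] with ζ hζ
    have hz : (r:ℂ) * ζ ∈ ball (0:ℂ) 1 := by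
      simp [hζ, abs_of_nonneg h0, h1]
    have := ((hasSum_taylorCoeff hf hz).mul_right ((starRingEnd ℂ) ζ ^ j * ζ ^ k)).tsum_eq
    rw [← this]
    apply tsum_congr
    intro l
    simp only [F, mul_pow]; ring
  have e2 : ∀ l, ∫ ζ, F l ζ ∂circleMeasure
      = if l + k = j then taylorCoeff f l * (r:ℂ) ^ l else 0 := by
    intro l
    simp only [F]
    rw [integral_const_mul, cm_orth]
    split_ifs <;> simp
  rw [e1] at hS
  simp_rw [e2] at hS
  refine hS.unique ?_
  split_ifs with h
  · have := hasSum_ite_eq (j - k) (taylorCoeff f (j - k) * (r:ℂ) ^ (j - k))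
    refine this.congr_fun ?_ |> id
    intro l
    by_cases hl : l = j - k
    · subst hl
      simp [Nat.sub_add_cancel h]
    · rw [if_neg hl, if_neg (by omega)]
  · have : (fun l => if l + k = j then taylorCoeff f l * (r:ℂ) ^ l else 0) = fun _ => (0:ℂ) := by
      funext l; rw [if_neg (by omega)]
    rw [this]; exact hasSum_zero

/-- sum of the partial sums -/
noncomputable def fejSum (f : ℂ → ℂ) (n : ℕ) (z : ℂ) : ℂ :=
  ∑ k ∈ Finset.range (n + 1), taylorPartial f k z

lemma fejSum_cont (f : ℂ → ℂ) (n : ℕ) : Continuous (fejSum f n) := by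
  unfold fejSum taylorPartial; fun_prop

lemma fejSum_bound_ball {f : ℂ → ℂ} (hf : DifferentiableOn ℂ f (ball (0:ℂ) 1)) {M : ℝ}
    (hM : ∀ z ∈ ball (0:ℂ) 1, ‖f z‖ ≤ M) (n : ℕ) {r : ℝ} (h0 : 0 ≤ r) (h1 : r < 1)
    {z : ℂ} (hz : ‖z‖ = 1) : ‖fejSum f n (r * z)‖ ≤ (n + 1) * M := by
  have hconj : Continuous (fun ζ : ℂ => (starRingEnd ℂ) ζ) := Complex.continuous_conj
  have hmap : ∀ ζ ∈ sphere (0:ℂ) 1, (r:ℂ) * ζ ∈ ball (0:ℂ) 1 := by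
    intro ζ hζ
    simp only [mem_sphere_zero_iff_norm] at hζ
    simp [hζ, abs_of_nonneg h0, h1]
  have hfc : ContinuousOn (fun ζ : ℂ => f (r * ζ)) (sphere (0:ℂ) 1) :=
    hf.continuousOn.comp (by fun_prop) hmap
  set D : ℂ → ℂ := fun ζ => ∑ j ∈ Finset.range (n + 1), (z * (starRingEnd ℂ) ζ) ^ j
  have hDc : Continuous D := by simp only [D]; fun_prop
  have hDD : ∀ ζ, ((‖D ζ‖ ^ 2 : ℝ) : ℂ) = ∑ j ∈ Finset.range (n + 1), ∑ k ∈ Finset.range (n + 1),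
      z ^ j * (starRingEnd ℂ) z ^ k * ((starRingEnd ℂ) ζ ^ j * ζ ^ k) := by
    intro ζ
    rw [← Complex.normSq_eq_norm_sq, ← Complex.mul_conj]
    simp only [D, map_sum, map_pow, map_mul, conj_conj]
    rw [Finset.sum_mul_sum]
    refine Finset.sum_congr rfl fun j _ => Finset.sum_congr rfl fun k _ => ?_
    rw [mul_pow, mul_pow]; ring
  have hzz : z * (starRingEnd ℂ) z = 1 := by
    rw [Complex.mul_conj, Complex.normSq_eq_norm_sq, hz]; simp
  have hone : ∫ ζ, ‖D ζ‖ ^ 2 ∂circleMeasure = n + 1 := by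
    have : ((∫ ζ, ‖D ζ‖ ^ 2 ∂circleMeasure : ℝ) : ℂ) = ((n + 1 : ℝ) : ℂ) := by
      rw [← integral_complex_ofReal]
      simp_rw [hDD]
      rw [integral_finsetSum]
      · have : ∀ j ∈ Finset.range (n + 1), ∫ ζ, ∑ k ∈ Finset.range (n + 1),
            z ^ j * (starRingEnd ℂ) z ^ k * ((starRingEnd ℂ) ζ ^ j * ζ ^ k) ∂circleMeasure = 1 := by
          intro j hj
          rw [integral_finsetSum]
          · have e : ∀ k, ∫ ζ, z ^ j * (starRingEnd ℂ) z ^ k * ((starRingEnd ℂ) ζ ^ j * ζ ^ k) ∂circleMeasure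
                = if k = j then 1 else 0 := by
              intro k
              rw [integral_const_mul]
              have := cm_orth 0 j k
              simp only [pow_zero, one_mul, zero_add] at this
              rw [this]
              split_ifs with h
              · subst h; rw [mul_one, ← mul_pow, hzz, one_pow]
              · simp
            simp_rw [e]
            simp at hj
            simp [hj]
          · intro k _
            exact cm_integrable (by fun_prop)
        rw [Finset.sum_congr rfl this]
        simp
      · intro j _
        exact cm_integrable (by fun_prop)
    exact_mod_cast this
  have hrep : fejSum f n (r * z) = ∫ ζ, f (r * ζ) * ((‖D ζ‖ ^ 2 : ℝ) : ℂ) ∂circleMeasure := by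
    simp_rw [hDD, Finset.mul_sum]
    rw [integral_finsetSum]
    · unfold fejSum
      refine Finset.sum_congr rfl fun j hj => ?_
      rw [integral_finsetSum]
      · have e : ∀ k, ∫ ζ, f (r * ζ) * (z ^ j * (starRingEnd ℂ) z ^ k * ((starRingEnd ℂ) ζ ^ j * ζ ^ k)) ∂circleMeasure
            = if k < j + 1 then taylorCoeff f (j - k) * ((r:ℂ) * z) ^ (j - k) else 0 := by
          intro k
          have : ∀ ζ : ℂ, f (r * ζ) * (z ^ j * (starRingEnd ℂ) z ^ k * ((starRingEnd ℂ) ζ ^ j * ζ ^ k))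
              = z ^ j * (starRingEnd ℂ) z ^ k * (f (r * ζ) * ((starRingEnd ℂ) ζ ^ j * ζ ^ k)) := by
            intro ζ; ring
          simp_rw [this]
          rw [integral_const_mul, moment hf hM h0 h1]
          by_cases h : k ≤ j
          · rw [if_pos h, if_pos (by omega)]
            have : z ^ j * (starRingEnd ℂ) z ^ k = z ^ (j - k) := by
              conv_lhs => rw [← Nat.sub_add_cancel h]
              rw [pow_add, mul_assoc, ← mul_pow, hzz, one_pow, mul_one]
            rw [this, mul_pow]; ring
          · rw [if_neg h, if_neg (by omega), mul_zero]
        simp_rw [e]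
        rw [← Finset.sum_filter]
        have hfil : (Finset.range (n + 1)).filter (fun k => k < j + 1) = Finset.range (j + 1) := by
          ext k; simp at hj ⊢; omega
        rw [hfil]
        unfold taylorPartial
        rw [← Finset.sum_range_reflect]
        refine Finset.sum_congr rfl fun k hk => ?_
        simp at hk
        have : j + 1 - 1 - k = j - k := by omega
        rw [this]
      · intro k _
        exact cm_integrable (hfc.mul (by fun_prop))
    · intro j _
      exact cm_integrable (continuousOn_finsetSum _ fun k _ => (hfc.mul (by fun_prop)))
  rw [hrep]
  calc ‖∫ ζ, f (r * ζ) * ((‖D ζ‖ ^ 2 : ℝ) : ℂ) ∂circleMeasure‖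
      ≤ ∫ ζ, M * ‖D ζ‖ ^ 2 ∂circleMeasure := by
        apply norm_integral_le_of_norm_le (cm_integrable (by fun_prop))
        filter_upwards [cm_ae_norm] with ζ hζ
        rw [norm_mul, Complex.norm_real, Real.norm_of_nonneg (by positivity)]
        gcongr
        exact hM _ (hmap ζ (by simpa using hζ))
    _ = (n + 1) * M := by rw [integral_const_mul, hone]; ring

lemma fejSum_bound {f : ℂ → ℂ} (hf : DifferentiableOn ℂ f (ball (0:ℂ) 1)) {M : ℝ}
    (hM : ∀ z ∈ ball (0:ℂ) 1, ‖f z‖ ≤ M) (n : ℕ) {z : ℂ} (hz : ‖z‖ ≤ 1) :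
    ‖fejSum f n z‖ ≤ (n + 1) * M := by
  have h1 : ∀ w ∈ ball (0:ℂ) 1, ‖fejSum f n w‖ ≤ (n + 1) * M := by
    intro w hw
    rw [← Complex.norm_mul_exp_arg_mul_I w]
    exact fejSum_bound_ball hf hM n (norm_nonneg w) (by simpa using hw)
      (Complex.norm_exp_ofReal_mul_I _)
  have h2 : z ∈ closure (ball (0:ℂ) 1) := by
    rw [closure_ball _ one_ne_zero]; simpa using hz
  exact closure_minimal (s := ball (0:ℂ) 1) (t := {w | ‖fejSum f n w‖ ≤ (n + 1) * M}) h1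
    (isClosed_le (fejSum_cont f n).norm continuous_const) h2

lemma pow_sub_pow_le {z w : ℂ} (hz : ‖z‖ ≤ 1) (hw : ‖w‖ ≤ 1) (k : ℕ) :
    ‖z ^ k - w ^ k‖ ≤ k * ‖z - w‖ := by
  induction k with
  | zero => simp
  | succ k ih =>
    have : z ^ (k + 1) - w ^ (k + 1) = z * (z ^ k - w ^ k) + (z - w) * w ^ k := by ring
    rw [this]
    refine (norm_add_le _ _).trans ?_
    rw [norm_mul, norm_mul, norm_pow]
    have h1 : ‖w‖ ^ k ≤ 1 := pow_le_one₀ (norm_nonneg _) hw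
    have h2 : ‖z‖ * ‖z ^ k - w ^ k‖ ≤ 1 * (k * ‖z - w‖) := by gcongr
    have h3 : ‖z - w‖ * ‖w‖ ^ k ≤ ‖z - w‖ * 1 := by gcongr
    push_cast; linarith

lemma fejSum_lip {f : ℂ → ℂ} (hf : DifferentiableOn ℂ f (ball (0:ℂ) 1)) {M : ℝ}
    (hM : ∀ z ∈ ball (0:ℂ) 1, ‖f z‖ ≤ M) (n : ℕ) {z w : ℂ} (hz : ‖z‖ ≤ 1) (hw : ‖w‖ ≤ 1) :
    ‖fejSum f n z - fejSum f n w‖ ≤ (n + 1) * (M * (n + 1) ^ 2 * ‖z - w‖) := by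
  have hM0 : 0 ≤ M := (norm_nonneg _).trans (hM 0 (by simp))
  unfold fejSum
  rw [← Finset.sum_sub_distrib]
  have h1 : ∀ j ∈ Finset.range (n + 1), ‖taylorPartial f j z - taylorPartial f j w‖
      ≤ M * (n + 1) ^ 2 * ‖z - w‖ := by
    intro j hj
    unfold taylorPartial
    rw [← Finset.sum_sub_distrib]
    have h2 : ∀ k ∈ Finset.range (j + 1), ‖taylorCoeff f k * z ^ k - taylorCoeff f k * w ^ k‖
        ≤ M * ((n + 1) * ‖z - w‖) := by
      intro k hk
      rw [← mul_sub, norm_mul]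
      have hkn : (k:ℝ) ≤ n + 1 := by
        simp at hj hk
        have : k ≤ n + 1 := by omega
        exact_mod_cast this
      have := norm_taylorCoeff_le hf hM k
      have h3 := pow_sub_pow_le hz hw k
      calc _ ≤ M * (k * ‖z - w‖) := by gcongr
        _ ≤ _ := by gcongr
    refine (norm_sum_le_of_le _ h2).trans ?_
    rw [Finset.sum_const, Finset.card_range, nsmul_eq_mul]
    have : ((j + 1 : ℕ) : ℝ) ≤ n + 1 := by
      simp at hj
      have : j + 1 ≤ n + 1 := by omega
      exact_mod_cast this
    calc _ ≤ ((n:ℝ) + 1) * (M * ((n + 1) * ‖z - w‖)) := by gcongr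
      _ = _ := by ring
  refine (norm_sum_le_of_le _ h1).trans ?_
  rw [Finset.sum_const, Finset.card_range, nsmul_eq_mul]
  push_cast
  exact le_rfl

/-- key pointwise kernel bound for the Cesàro sums -/
lemma fejSum_ker {f : ℂ → ℂ} (hf : DifferentiableOn ℂ f (ball (0:ℂ) 1)) {M : ℝ}
    (hM : ∀ z ∈ ball (0:ℂ) 1, ‖f z‖ ≤ M) (n : ℕ) {ζ η : ℂ} {r : ℝ} (hζ : ‖ζ‖ = 1) (hη : ‖η‖ = 1)
    (h0 : 0 ≤ r) (h1 : r ≤ 1) :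
    ‖fejSum f n ζ - fejSum f n (r * η)‖ ≤ (n + 1) * (5 * M * logKer (dl n) ζ η) * ‖ζ - r * η‖ := by
  have hM0 : 0 ≤ M := (norm_nonneg _).trans (hM 0 (by simp))
  have hrη : ‖(r:ℂ) * η‖ = r := by simp [hη, abs_of_nonneg h0]
  set X := ‖fejSum f n ζ - fejSum f n (r * η)‖ with hX
  set d := ‖ζ - r * η‖ with hd
  have hX0 : 0 ≤ X := norm_nonneg _
  have hd0 : 0 ≤ d := norm_nonneg _
  have a1 : X ≤ (n + 1) * (M * (n + 1) ^ 2 * d) := fejSum_lip hf hM n hζ.le (hrη.le.trans h1)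
  have a2 : X ≤ 2 * ((n + 1) * M) := by
    refine (norm_sub_le _ _).trans ?_
    have := fejSum_bound hf hM n hζ.le
    have := fejSum_bound hf hM n (hrη.le.trans h1)
    linarith
  have a3 : ‖ζ - η‖ ≤ 2 * d := by
    have b1 : ‖ζ - η‖ ≤ ‖ζ - r * η‖ + ‖r * η - η‖ := by
      have := norm_add_le (ζ - r * η) (r * η - η); simpa using this
    have b2 : ‖(r:ℂ) * η - η‖ = 1 - r := by
      have : (r:ℂ) * η - η = ((r - 1 : ℝ) : ℂ) * η := by push_cast; ring
      rw [this, norm_mul, hη, Complex.norm_real, Real.norm_eq_abs, abs_of_nonpos (by linarith)]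
      ring
    have b3 : 1 - r ≤ d := by
      have := norm_sub_norm_le ζ (r * η)
      rw [hζ, hrη] at this; exact this
    linarith
  have hδ := dl_pos n
  have hn : (0:ℝ) < (n:ℝ) + 1 := by positivity
  unfold logKer
  have hden : 0 < dl n + ‖ζ - η‖ := by positivity
  rw [show (n + 1) * (5 * M * (1 / (dl n + ‖ζ - η‖))) * d = ((n + 1) * (5 * M) * d) / (dl n + ‖ζ - η‖) by ring,
    le_div_iff₀ hden]
  have c1 : X * dl n ≤ (n + 1) * M * d := by
    calc X * dl n ≤ ((n + 1) * (M * (n + 1) ^ 2 * d)) * dl n := by gcongr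
      _ = (n + 1) * M * d := by unfold dl; field_simp
  have c2 : X * ‖ζ - η‖ ≤ 2 * ((n + 1) * M) * (2 * d) := by gcongr
  nlinarith

end fejer


/-! ### Convex sequences -/

/-- first difference -/
def dd (α : ℕ → ℝ) (n : ℕ) : ℝ := α n - α (n + 1)

/-- second difference -/
def ee (α : ℕ → ℝ) (n : ℕ) : ℝ := dd α n - dd α (n + 1)

structure GoodSeq (α : ℕ → ℝ) : Prop where
  nonneg : ∀ n, 0 ≤ α n
  dd_nonneg : ∀ n, 0 ≤ dd α n
  ee_nonneg : ∀ n, 0 ≤ ee α n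
  tend : Filter.Tendsto α Filter.atTop (nhds 0)
  summ : Summable (fun n : ℕ => α (n + 1) / ((n : ℝ) + 2))

lemma abel_real (w β : ℕ → ℝ) (N : ℕ) :
    ∑ n ∈ Finset.range N, w n * (β n - β (n + 1)) + w N * β N
      = w 0 * β 0 + ∑ n ∈ Finset.range N, (w (n + 1) - w n) * β (n + 1) := by
  induction N with
  | zero => simp
  | succ N ih => rw [Finset.sum_range_succ, Finset.sum_range_succ]; linarith

lemma log_step (n : ℕ) : Real.log ((n:ℝ) + 3) - Real.log ((n:ℝ) + 2) ≤ 1 / ((n:ℝ) + 2) := by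
  rw [← Real.log_div (by positivity) (by positivity)]
  refine (Real.log_le_sub_one_of_pos (by positivity)).trans (le_of_eq ?_)
  field_simp; ring

lemma log_two_le (n : ℕ) : 1 / 2 ≤ Real.log ((n:ℝ) + 2) := by
  have h := Real.log_two_gt_d9
  have : Real.log 2 ≤ Real.log ((n:ℝ) + 2) := Real.log_le_log (by norm_num) (by
    have : (0:ℝ) ≤ n := Nat.cast_nonneg n
    linarith)
  linarith

lemma log_three_ge (n : ℕ) : 1 ≤ Real.log ((n:ℝ) + 3) := by
  rw [Real.le_log_iff_exp_le (by positivity)]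
  have h := Real.exp_one_lt_d9
  have : (0:ℝ) ≤ n := Nat.cast_nonneg n
  linarith

lemma GoodSeq.bound {α : ℕ → ℝ} (h : GoodSeq α) : ∃ B, ∀ N : ℕ,
    ∑ n ∈ Finset.range N, (((n:ℝ) + 1) * Real.log ((n:ℝ) + 2)) * ee α n ≤ B ∧
    (((N:ℝ) + 1) * Real.log ((N:ℝ) + 2)) * dd α N ≤ B := by
  set v : ℕ → ℝ := fun n => Real.log ((n:ℝ) + 2) with hv
  have hv0 : ∀ n, 0 ≤ v n := fun n => le_trans (by norm_num) (log_two_le n)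
  have hvs : ∀ n, v (n + 1) = Real.log ((n:ℝ) + 3) := by
    intro n; simp only [hv]; push_cast; congr 1; ring
  set B1 := v 0 * α 0 + ∑' n : ℕ, α (n + 1) / ((n : ℝ) + 2) with hB1
  have h1 : ∀ N, ∑ n ∈ Finset.range N, v n * dd α n ≤ B1 := by
    intro N
    have a := abel_real v α N
    have b : ∑ n ∈ Finset.range N, (v (n + 1) - v n) * α (n + 1)
        ≤ ∑ n ∈ Finset.range N, α (n + 1) / ((n : ℝ) + 2) := by
      apply Finset.sum_le_sum
      intro n _
      have := log_step n
      rw [← hvs] at this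
      calc (v (n + 1) - v n) * α (n + 1) ≤ (1 / ((n:ℝ) + 2)) * α (n + 1) := by
            gcongr
            exact h.nonneg _
        _ = _ := by ring
    have c := h.summ.sum_le_tsum (Finset.range N) (fun n _ => div_nonneg (h.nonneg _) (by positivity))
    have d : 0 ≤ v N * α N := mul_nonneg (hv0 N) (h.nonneg N)
    simp only [dd]
    linarith
  set w : ℕ → ℝ := fun n => ((n:ℝ) + 1) * v n with hw
  have hw0 : ∀ n, 0 ≤ w n := fun n => mul_nonneg (by positivity) (hv0 n)
  have hws : ∀ n, w (n + 1) - w n ≤ 2 * v (n + 1) := by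
    intro n
    have a := log_step n
    rw [← hvs] at a
    have b := log_three_ge n
    rw [← hvs] at b
    have c : ((n:ℝ) + 1) * (v (n + 1) - v n) ≤ 1 := by
      calc ((n:ℝ) + 1) * (v (n + 1) - v n) ≤ ((n:ℝ) + 1) * (1 / ((n:ℝ) + 2)) := by gcongr
        _ ≤ 1 := by rw [mul_one_div, div_le_one (by positivity)]; linarith
    simp only [hw]; push_cast
    nlinarith
  have h2 : ∀ N, ∑ n ∈ Finset.range N, w n * ee α n + w N * dd α N ≤ w 0 * dd α 0 + 2 * B1 := by
    intro N
    have a := abel_real w (dd α) N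
    have b : ∑ n ∈ Finset.range N, (w (n + 1) - w n) * dd α (n + 1)
        ≤ ∑ n ∈ Finset.range N, 2 * (v (n + 1) * dd α (n + 1)) := by
      apply Finset.sum_le_sum
      intro n _
      have := mul_le_mul_of_nonneg_right (hws n) (h.dd_nonneg (n + 1))
      linarith
    rw [← Finset.mul_sum] at b
    have c := h1 (N + 1)
    rw [Finset.sum_range_succ'] at c
    have d := mul_nonneg (hv0 0) (h.dd_nonneg 0)
    simp only [ee]
    linarith
  refine ⟨w 0 * dd α 0 + 2 * B1, fun N => ⟨?_, ?_⟩⟩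
  · have := h2 N
    have := mul_nonneg (hw0 N) (h.dd_nonneg N)
    linarith
  · have := h2 N
    have : 0 ≤ ∑ n ∈ Finset.range N, w n * ee α n :=
      Finset.sum_nonneg fun n _ => mul_nonneg (hw0 n) (h.ee_nonneg n)
    linarith

lemma GoodSeq.summ_log {α : ℕ → ℝ} (h : GoodSeq α) :
    Summable (fun n : ℕ => (((n:ℝ) + 1) * ee α n) * Real.log ((n:ℝ) + 2)) := by
  obtain ⟨B, hB⟩ := h.bound
  refine summable_of_sum_range_le (c := B) (fun n => ?_) (fun N => ?_)
  · have := h.ee_nonneg n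
    have := log_two_le n
    positivity
  · refine le_trans (le_of_eq ?_) (hB N).1
    exact Finset.sum_congr rfl fun n _ => by ring

lemma GoodSeq.summ_ee {α : ℕ → ℝ} (h : GoodSeq α) :
    Summable (fun n : ℕ => ((n:ℝ) + 1) * ee α n) := by
  refine Summable.of_nonneg_of_le (fun n => ?_) (fun n => ?_) (h.summ_log.mul_left 2)
  · have := h.ee_nonneg n
    positivity
  · have h1 := h.ee_nonneg n
    have h2 := log_two_le n
    have h3 : 0 ≤ ((n:ℝ) + 1) * ee α n := by positivity
    nlinarith

lemma GoodSeq.tend_dd {α : ℕ → ℝ} (h : GoodSeq α) :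
    Filter.Tendsto (fun n : ℕ => ((n:ℝ) + 1) * dd α n) Filter.atTop (nhds 0) := by
  obtain ⟨B, hB⟩ := h.bound
  have h1 : Filter.Tendsto (fun n : ℕ => B / Real.log ((n:ℝ) + 2)) Filter.atTop (nhds 0) := by
    apply Filter.Tendsto.const_div_atTop
    apply Real.tendsto_log_atTop.comp
    exact Filter.tendsto_atTop_add_const_right _ _ tendsto_natCast_atTop_atTop
  refine squeeze_zero (fun n => mul_nonneg (by positivity) (h.dd_nonneg n)) (fun n => ?_) h1
  have := log_two_le n
  rw [le_div_iff₀ (by linarith)]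
  have := (hB n).2
  linarith

lemma abel_cplx (β : ℕ → ℝ) (x : ℕ → ℂ) (N : ℕ) :
    ∑ k ∈ Finset.range (N + 1), x k * (β k : ℂ)
      = ∑ n ∈ Finset.range N, ((dd β n : ℝ) : ℂ) * (∑ k ∈ Finset.range (n + 1), x k)
        + (β N : ℂ) * (∑ k ∈ Finset.range (N + 1), x k) := by
  induction N with
  | zero => simp [mul_comm]
  | succ N ih =>
    rw [Finset.sum_range_succ, ih, Finset.sum_range_succ (f := fun n => ((dd β n : ℝ) : ℂ) * _),
      Finset.sum_range_succ x (N + 1)]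
    simp only [dd]; push_cast; ring

lemma seqConv_eq {α : ℕ → ℝ} (h : GoodSeq α) {f : ℂ → ℂ}
    (hf : DifferentiableOn ℂ f (ball (0:ℂ) 1)) {M : ℝ}
    (hM : ∀ z ∈ ball (0:ℂ) 1, ‖f z‖ ≤ M) {z : ℂ} (hz : z ∈ ball (0:ℂ) 1) :
    seqConv f α z = ∑' n, ((ee α n : ℝ) : ℂ) * fejSum f n z := by
  have hM0 : 0 ≤ M := (norm_nonneg _).trans (hM 0 (by simp))
  have hz1 : ‖z‖ < 1 := by simpa using hz
  set x : ℕ → ℂ := fun k => taylorCoeff f k * z ^ k with hx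
  have hA : Summable (fun k => x k * (α k : ℂ)) := by
    apply Summable.of_norm_bounded (g := fun k => (M * α 0) * ‖z‖ ^ k)
      ((summable_geometric_of_lt_one (norm_nonneg z) hz1).mul_left _)
    intro k
    have ha : α k ≤ α 0 := by
      have : Antitone α := antitone_nat_of_succ_le fun n => by
        have := h.dd_nonneg n; simp only [dd] at this; linarith
      exact this (Nat.zero_le k)
    have hk := h.nonneg k
    simp only [hx, norm_mul, norm_pow, Complex.norm_real, Real.norm_of_nonneg hk]
    have := norm_taylorCoeff_le hf hM k
    calc ‖taylorCoeff f k‖ * ‖z‖ ^ k * α k ≤ M * ‖z‖ ^ k * α 0 := by gcongr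
      _ = _ := by ring
  have hS : Summable (fun n => ((ee α n : ℝ) : ℂ) * fejSum f n z) := by
    apply Summable.of_norm_bounded (h.summ_ee.mul_right M)
    intro n
    have hn := h.ee_nonneg n
    rw [norm_mul, Complex.norm_real, Real.norm_of_nonneg hn]
    have := fejSum_bound hf hM n hz1.le
    calc ee α n * ‖fejSum f n z‖ ≤ ee α n * ((n + 1) * M) := by gcongr
      _ = _ := by ring
  have hT1 := (hA.hasSum.tendsto_sum_nat).comp (Filter.tendsto_add_atTop_nat 2)
  have hT2 := hS.hasSum.tendsto_sum_nat
  have hpart : Filter.Tendsto (fun N => ∑ k ∈ Finset.range N, x k) Filter.atTop (nhds (f z)) :=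
    (hasSum_taylorCoeff hf hz).tendsto_sum_nat
  have hT3 : Filter.Tendsto (fun N => (α (N + 1) : ℂ) * (∑ k ∈ Finset.range (N + 1 + 1), x k))
      Filter.atTop (nhds (((0:ℝ):ℂ) * f z)) := by
    apply Filter.Tendsto.mul
    · exact (Complex.continuous_ofReal.tendsto 0).comp (h.tend.comp (Filter.tendsto_add_atTop_nat 1))
    · exact hpart.comp (Filter.tendsto_add_atTop_nat 2)
  have hT4 : Filter.Tendsto (fun N => ((dd α N : ℝ) : ℂ) * fejSum f N z) Filter.atTop (nhds 0) := by
    apply squeeze_zero_norm (a := fun N : ℕ => (((N:ℝ) + 1) * dd α N) * M)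
    · intro N
      have hn := h.dd_nonneg N
      rw [norm_mul, Complex.norm_real, Real.norm_of_nonneg hn]
      have := fejSum_bound hf hM N hz1.le
      calc dd α N * ‖fejSum f N z‖ ≤ dd α N * ((N + 1) * M) := by gcongr
        _ = _ := by ring
    · simpa using h.tend_dd.mul_const M
  have hid : ∀ N, ∑ k ∈ Finset.range (N + 2), x k * (α k : ℂ)
      = ∑ n ∈ Finset.range N, ((ee α n : ℝ) : ℂ) * fejSum f n z
        + ((dd α N : ℝ) : ℂ) * fejSum f N z
        + (α (N + 1) : ℂ) * (∑ k ∈ Finset.range (N + 1 + 1), x k) := by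
    intro N
    rw [abel_cplx α x (N + 1)]
    have := abel_cplx (dd α) (fun n => ∑ k ∈ Finset.range (n + 1), x k) N
    congr 1
    simp only [fejSum, taylorPartial]
    rw [← Finset.sum_congr rfl (fun n _ => mul_comm _ _)]
    exact this
  have hT5 := (hT2.add hT4).add hT3
  have hT6 : Filter.Tendsto (fun N => ∑ k ∈ Finset.range (N + 2), x k * (α k : ℂ)) Filter.atTop
      (nhds (∑' n, ((ee α n : ℝ) : ℂ) * fejSum f n z + 0 + ((0:ℝ):ℂ) * f z)) := by
    refine hT5.congr ?_
    intro N; rw [hid N]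
  have := tendsto_nhds_unique hT1 hT6
  simp only [ofReal_zero, zero_mul, add_zero] at this
  rw [← this]
  unfold seqConv
  exact tsum_congr fun k => by simp only [hx]; ring

/-! ### The concrete sequence -/

lemma conv_mul {p0 p1 p2 q0 q1 q2 : ℝ} (hp2 : 0 ≤ p2) (hq2 : 0 ≤ q2) (h1 : p1 ≤ p0) (h2 : p2 ≤ p1)
    (k1 : q1 ≤ q0) (k2 : q2 ≤ q1) (hp : 2 * p1 ≤ p0 + p2) (hq : 2 * q1 ≤ q0 + q2) :
    2 * (p1 * q1) ≤ p0 * q0 + p2 * q2 := by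
  nlinarith [mul_nonneg (sub_nonneg.2 h1) (sub_nonneg.2 k1),
    mul_nonneg (sub_nonneg.2 h2) (sub_nonneg.2 k2),
    mul_nonneg (hp2.trans h2) (sub_nonneg.2 hq), mul_nonneg (hq2.trans k2) (sub_nonneg.2 hp)]

lemma log_conc {a b c : ℝ} (ha : 0 < a) (hb : 0 < b) (hc : 0 < c) (h : a + c ≤ 2 * b) :
    Real.log a + Real.log c ≤ 2 * Real.log b := by
  rw [← Real.log_mul ha.ne' hc.ne']
  have : (2:ℝ) * Real.log b = Real.log (b ^ 2) := by rw [Real.log_pow]; norm_num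
  rw [this]
  apply Real.log_le_log (by positivity)
  nlinarith [sq_nonneg (a - c)]

/-- tangent line bound for negative powers -/
lemma rpow_tangent {s a b : ℝ} (hs : 0 < s) (ha : 0 < a) (hb : 0 < b) :
    b ^ (-s) - s * b ^ (-s - 1) * (a - b) ≤ a ^ (-s) := by
  have e1 : b ^ (-s - 1) = b ^ (-s) / b := by
    rw [Real.rpow_sub hb, Real.rpow_one]
  have e2 : a ^ (-s) = b ^ (-s) * (a / b) ^ (-s) := by
    rw [← Real.mul_rpow hb.le (by positivity)]
    congr 1; field_simp
  have e3 : 1 - s * (a / b - 1) ≤ (a / b) ^ (-s) := by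
    rw [Real.rpow_def_of_pos (by positivity)]
    have h1 := Real.add_one_le_exp (Real.log (a / b) * -s)
    have h2 := Real.log_le_sub_one_of_pos (show 0 < a / b by positivity)
    nlinarith
  rw [e1, e2]
  have h3 : 0 < b ^ (-s) := Real.rpow_pos_of_pos hb _
  calc b ^ (-s) - s * (b ^ (-s) / b) * (a - b) = b ^ (-s) * (1 - s * (a / b - 1)) := by
        field_simp
    _ ≤ _ := mul_le_mul_of_nonneg_left e3 h3.le

lemma log_log_pos (n : ℕ) : 0 < Real.log (Real.log ((n:ℝ) + 3)) := by
  apply Real.log_pos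
  rw [Real.lt_log_iff_exp_lt (by positivity)]
  have h := Real.exp_one_lt_d9
  have : (0:ℝ) ≤ n := Nat.cast_nonneg n
  linarith

noncomputable def alp (ε : ℝ) : ℕ → ℝ := fun n : ℕ =>
  1 / (Real.log ((n : ℝ) + 2) * Real.log (Real.log ((n : ℝ) + 3)) ^ (1 + ε))

lemma summable_of_telescope {u ψ : ℕ → ℝ} (hu : ∀ n, 0 ≤ u n) (hψ : ∀ n, 0 ≤ ψ n)
    (h : ∀ n, u n ≤ ψ n - ψ (n + 1)) : Summable u := by
  refine summable_of_sum_range_le (c := ψ 0) hu (fun N => ?_)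
  have : ∑ n ∈ Finset.range N, u n ≤ ψ 0 - ψ N := by
    rw [← Finset.sum_range_sub']
    exact Finset.sum_le_sum fun n _ => h n
  have := hψ N
  linarith

lemma alp_good {ε : ℝ} (hε : 0 < ε) : GoodSeq (alp ε) := by
  set p : ℕ → ℝ := fun n => (Real.log ((n : ℝ) + 2))⁻¹ with hp
  set q : ℕ → ℝ := fun n => (Real.log (Real.log ((n : ℝ) + 3))) ^ (-(1 + ε)) with hq
  have hl : ∀ n : ℕ, 0 < Real.log ((n:ℝ) + 2) := fun n => by have := log_two_le n; linarith
  have hpq : ∀ n, alp ε n = p n * q n := by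
    intro n
    simp only [alp, hp, hq]
    rw [Real.rpow_neg (log_log_pos n).le, one_div, mul_inv]
  have hp0 : ∀ n, 0 ≤ p n := fun n => inv_nonneg.2 (hl n).le
  have hq0 : ∀ n, 0 ≤ q n := fun n => Real.rpow_nonneg (log_log_pos n).le _
  have hc : ∀ n : ℕ, (0:ℝ) ≤ n := fun n => Nat.cast_nonneg n
  have hpm : ∀ n, p (n + 1) ≤ p n := by
    intro n
    simp only [hp]
    apply inv_anti₀ (hl n)
    apply Real.log_le_log (by have := hc n; positivity)
    push_cast; linarith
  have hq' : ∀ n : ℕ, Real.log ((n:ℝ) + 3) ≤ Real.log (((n + 1 : ℕ):ℝ) + 3) := fun n => by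
    apply Real.log_le_log (by positivity)
    push_cast; linarith
  have hqm' : ∀ n : ℕ, Real.log (Real.log ((n:ℝ) + 3)) ≤ Real.log (Real.log (((n + 1 : ℕ):ℝ) + 3)) :=
    fun n => Real.log_le_log (by have := log_three_ge n; linarith) (hq' n)
  have hqm : ∀ n, q (n + 1) ≤ q n := by
    intro n
    simp only [hq]
    exact Real.rpow_le_rpow_of_nonpos (log_log_pos n) (hqm' n) (by linarith)
  have hpc : ∀ n, 2 * p (n + 1) ≤ p n + p (n + 2) := by
    intro n
    simp only [hp]
    have h0 := hl n
    have h1 := hl (n + 1)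
    have h2 := hl (n + 2)
    have hcc : Real.log ((n:ℝ) + 2) + Real.log (((n + 2 : ℕ):ℝ) + 2) ≤ 2 * Real.log (((n + 1 : ℕ):ℝ) + 2) := by
      apply log_conc (by positivity) (by positivity) (by positivity)
      push_cast; linarith
    set x := Real.log ((n:ℝ) + 2)
    set y := Real.log (((n + 1 : ℕ):ℝ) + 2)
    set z := Real.log (((n + 2 : ℕ):ℝ) + 2)
    have e : x⁻¹ + z⁻¹ = (x + z) / (x * z) := by field_simp; ring
    rw [e, ← div_eq_mul_inv, div_le_div_iff₀ h1 (by positivity)]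
    nlinarith [sq_nonneg (x - z), mul_nonneg (add_pos h0 h2).le (sub_nonneg.2 hcc)]
  have hqc : ∀ n, 2 * q (n + 1) ≤ q n + q (n + 2) := by
    intro n
    simp only [hq]
    have h0 := log_log_pos n
    have h1 := log_log_pos (n + 1)
    have h2 := log_log_pos (n + 2)
    have k : ∀ n : ℕ, 0 < Real.log ((n:ℝ) + 3) := fun n => by have := log_three_ge n; linarith
    have hcc : Real.log (Real.log ((n:ℝ) + 3)) + Real.log (Real.log (((n + 2 : ℕ):ℝ) + 3))
        ≤ 2 * Real.log (Real.log (((n + 1 : ℕ):ℝ) + 3)) := by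
      apply log_conc (k n) (k (n + 1)) (k (n + 2))
      apply log_conc (by positivity) (by positivity) (by positivity)
      push_cast; linarith
    set x := Real.log (Real.log ((n:ℝ) + 3))
    set y := Real.log (Real.log (((n + 1 : ℕ):ℝ) + 3))
    set z := Real.log (Real.log (((n + 2 : ℕ):ℝ) + 3))
    have t1 := rpow_tangent (s := 1 + ε) (by linarith) h0 h1
    have t2 := rpow_tangent (s := 1 + ε) (by linarith) h2 h1
    have t3 : 0 ≤ (1 + ε) * y ^ (-(1 + ε) - 1) := by positivity
    nlinarith
  have hdd : ∀ n, 0 ≤ dd (alp ε) n := by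
    intro n
    simp only [dd, hpq]
    have := mul_le_mul (hpm n) (hqm n) (hq0 _) (hp0 _)
    linarith
  refine ⟨fun n => ?_, hdd, fun n => ?_, ?_, ?_⟩
  · rw [hpq]; exact mul_nonneg (hp0 n) (hq0 n)
  · simp only [ee, dd, hpq]
    have := conv_mul (hp0 (n + 2)) (hq0 (n + 2)) (hpm n) (hpm (n + 1)) (hqm n) (hqm (n + 1))
      (hpc n) (hqc n)
    linarith
  · have hpt : Filter.Tendsto p Filter.atTop (nhds 0) := by
      apply Filter.Tendsto.inv_tendsto_atTop
      apply Real.tendsto_log_atTop.comp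
      exact Filter.tendsto_atTop_add_const_right _ _ tendsto_natCast_atTop_atTop
    have hqa : Antitone q := antitone_nat_of_succ_le hqm
    refine squeeze_zero (g := fun n => p n * q 0) (fun n => ?_) (fun n => ?_) (by simpa using hpt.mul_const (q 0))
    · rw [hpq]; exact mul_nonneg (hp0 n) (hq0 n)
    · rw [hpq]; exact mul_le_mul_of_nonneg_left (hqa (Nat.zero_le n)) (hp0 n)
  · -- telescoping
    set ψ : ℕ → ℝ := fun n => 4 / ε * (Real.log (Real.log ((n:ℝ) + 3))) ^ (-ε) with hψ
    refine summable_of_telescope (ψ := ψ) (fun n => ?_) (fun n => ?_) (fun n => ?_)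
    · rw [hpq]; exact div_nonneg (mul_nonneg (hp0 _) (hq0 _)) (by positivity)
    · have := log_log_pos n
      simp only [hψ]; positivity
    · have t := rpow_tangent (s := ε) hε (log_log_pos n) (log_log_pos (n + 1))
      rw [hpq]
      simp only [hp, hq, hψ]
      have hL0 := log_three_ge n
      have hL1 := log_three_ge (n + 1)
      have hx := log_log_pos n
      have hy := log_log_pos (n + 1)
      have e1 : (((n + 1 : ℕ)):ℝ) + 2 = (n:ℝ) + 3 := by push_cast; ring
      have e2 : (((n + 1 : ℕ)):ℝ) + 3 = (n:ℝ) + 4 := by push_cast; ring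
      rw [e1]
      rw [e2] at t hL1 hy ⊢
      set L0 := Real.log ((n:ℝ) + 3)
      set L1 := Real.log ((n:ℝ) + 4)
      set x := Real.log L0
      set y := Real.log L1
      -- `y - x ≥ 1 / ((n+4) L1)`
      have s1 : 1 / ((n:ℝ) + 4) ≤ L1 - L0 := by
        have := Real.one_sub_inv_le_log_of_pos (x := ((n:ℝ) + 4) / ((n:ℝ) + 3)) (by positivity)
        rw [Real.log_div (by positivity) (by positivity)] at this
        refine le_trans (le_of_eq ?_) this
        field_simp; ring
      have s2 : (L1 - L0) / L1 ≤ y - x := by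
        have := Real.one_sub_inv_le_log_of_pos (x := L1 / L0) (by positivity)
        rw [Real.log_div (by positivity) (by positivity)] at this
        refine le_trans (le_of_eq ?_) this
        field_simp
      have s3 : L1 ≤ 2 * L0 := by
        have : (2:ℝ) * L0 = Real.log (((n:ℝ) + 3) ^ 2) := by rw [Real.log_pow]; norm_num [L0]
        rw [this]
        apply Real.log_le_log (by positivity)
        nlinarith [hc n]
      have s4 : 1 / (4 * (((n:ℝ) + 2) * L0)) ≤ y - x := by
        calc 1 / (4 * (((n:ℝ) + 2) * L0)) = 1 / ((2 * ((n:ℝ) + 2)) * (2 * L0)) := by ring_nf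
          _ ≤ 1 / (((n:ℝ) + 4) * L1) := by
              apply one_div_le_one_div_of_le (by positivity)
              have := hc n
              apply mul_le_mul (by linarith) s3 (by positivity) (by positivity)
          _ = (1 / ((n:ℝ) + 4)) / L1 := by field_simp
          _ ≤ (L1 - L0) / L1 := by gcongr
          _ ≤ y - x := s2
      have e3 : -(1 + ε) = -ε - 1 := by ring
      rw [e3]
      set Y := y ^ (-ε - 1) with hY
      have hY0 : 0 ≤ Y := by positivity
      have s5 : Y * (1 / (4 * (((n:ℝ) + 2) * L0))) ≤ Y * (y - x) := by gcongr
      have s6 : Y * (y - x) ≤ 1 / ε * (x ^ (-ε) - y ^ (-ε)) := by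
        rw [div_mul_eq_mul_div, le_div_iff₀ hε]
        nlinarith
      calc L0⁻¹ * Y / ((n:ℝ) + 2) = 4 * (Y * (1 / (4 * (((n:ℝ) + 2) * L0)))) := by field_simp
        _ ≤ 4 * (1 / ε * (x ^ (-ε) - y ^ (-ε))) := by linarith
        _ = _ := by ring


/-- `F` is dominated on the closed disc by the square of a nice function, with equality on the
circle. -/
def SqDom (F : ℂ → ℂ) : Prop := ∃ k : ℂ → ℂ, DiffContOnCl ℂ k (ball 0 1) ∧
  (∀ z ∈ closedBall (0:ℂ) 1, ‖F z‖ ≤ ‖k z‖ ^ 2) ∧ ∀ z ∈ sphere (0:ℂ) 1, ‖F z‖ = ‖k z‖ ^ 2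

lemma SqDom.one : SqDom (fun _ => 1) :=
  ⟨fun _ => 1, diffContOnCl_const, by simp, by simp⟩

lemma SqDom.mul {F G : ℂ → ℂ} (hF : SqDom F) (hG : SqDom G) : SqDom (fun z => F z * G z) := by
  obtain ⟨k, k1, k2, k3⟩ := hF
  obtain ⟨l, l1, l2, l3⟩ := hG
  refine ⟨fun z => k z * l z, ⟨k1.1.mul l1.1, k1.2.mul l1.2⟩, fun z hz => ?_, fun z hz => ?_⟩
  · rw [norm_mul, norm_mul, mul_pow]
    exact mul_le_mul (k2 z hz) (l2 z hz) (norm_nonneg _) (by positivity)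
  · rw [norm_mul, norm_mul, mul_pow, k3 z hz, l3 z hz]

lemma SqDom.prod {ι : Type*} (s : Finset ι) (F : ι → ℂ → ℂ) (h : ∀ i ∈ s, SqDom (F i)) :
    SqDom (fun z => ∏ i ∈ s, F i z) := by
  classical
  induction s using Finset.induction_on with
  | empty => simpa using SqDom.one
  | insert i s hi ih =>
    simp only [Finset.prod_insert hi]
    exact SqDom.mul (h i (by simp)) (ih fun j hj => h j (by simp [hj]))

lemma SqDom.pow {F : ℂ → ℂ} (h : SqDom F) (n : ℕ) : SqDom (fun z => F z ^ n) := by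
  have := SqDom.prod (Finset.range n) (fun _ => F) (fun _ _ => h)
  simpa using this

lemma norm_sq_sub (u z : ℂ) : ‖1 - (starRingEnd ℂ) u * z‖ ^ 2 - ‖z - u‖ ^ 2
    = (1 - ‖u‖ ^ 2) * (1 - ‖z‖ ^ 2) := by
  simp only [← Complex.normSq_eq_norm_sq, Complex.normSq_apply]
  simp; ring

lemma SqDom.linear {u : ℂ} (hu : ‖u‖ ≤ 1) : SqDom (fun z => z - u) := by
  have hre : ∀ z : ℂ, ‖z‖ ≤ 1 → 0 ≤ (1 - (starRingEnd ℂ) u * z).re := by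
    intro z hz
    have h1 : ‖(starRingEnd ℂ) u * z‖ ≤ 1 := by
      rw [norm_mul, RCLike.norm_conj]; exact mul_le_one₀ hu (norm_nonneg _) hz
    have := (Complex.re_le_norm ((starRingEnd ℂ) u * z)).trans h1
    rw [Complex.sub_re, Complex.one_re]; linarith
  have hre' : ∀ z : ℂ, ‖z‖ < 1 → 0 < (1 - (starRingEnd ℂ) u * z).re := by
    intro z hz
    have h1 : ‖(starRingEnd ℂ) u * z‖ < 1 := by
      rw [norm_mul, RCLike.norm_conj]
      calc ‖u‖ * ‖z‖ ≤ 1 * ‖z‖ := by gcongr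
        _ < 1 := by linarith
    have := (Complex.re_le_norm ((starRingEnd ℂ) u * z)).trans_lt h1
    rw [Complex.sub_re, Complex.one_re]; linarith
  have hk : ∀ z : ℂ, ‖(1 - (starRingEnd ℂ) u * z) ^ (1 / 2 : ℂ)‖ ^ 2
      = ‖1 - (starRingEnd ℂ) u * z‖ := by
    intro z
    rw [← norm_pow]
    congr 1
    simp
  refine ⟨fun z => (1 - (starRingEnd ℂ) u * z) ^ (1 / 2 : ℂ), ⟨?_, ?_⟩, ?_, ?_⟩
  · intro z hz
    have hz1 : ‖z‖ < 1 := by simpa using hz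
    apply DifferentiableAt.differentiableWithinAt
    apply DifferentiableAt.cpow_const (by fun_prop)
    left; exact hre' z hz1
  · rw [closure_ball _ one_ne_zero]
    intro z hz
    have hz1 : ‖z‖ ≤ 1 := by simpa using hz
    apply ContinuousAt.continuousWithinAt
    by_cases h0 : 1 - (starRingEnd ℂ) u * z = 0
    · have hc : ContinuousAt (fun w : ℂ => w ^ (1 / 2 : ℂ)) (1 - (starRingEnd ℂ) u * z) := by
        rw [h0]
        have := Complex.continuousAt_cpow_zero_of_re_pos (z := (1 / 2 : ℂ)) (by norm_num)
        exact ContinuousAt.comp (f := fun w : ℂ => (w, (1 / 2 : ℂ))) (x := (0:ℂ)) this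
          (by fun_prop)
      exact ContinuousAt.comp (f := fun z : ℂ => 1 - (starRingEnd ℂ) u * z)
        (g := fun w : ℂ => w ^ (1 / 2 : ℂ)) hc (by fun_prop)
    · apply ContinuousAt.cpow (by fun_prop) continuousAt_const
      rw [Complex.mem_slitPlane_iff]
      by_contra hcon
      push Not at hcon
      apply h0
      apply Complex.ext
      · exact le_antisymm hcon.1 (hre z hz1)
      · exact hcon.2
  · intro z hz
    have hz1 : ‖z‖ ≤ 1 := by simpa using hz
    rw [hk]
    have h := norm_sq_sub u z
    have : 0 ≤ (1 - ‖u‖ ^ 2) * (1 - ‖z‖ ^ 2) := by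
      apply mul_nonneg <;> nlinarith [norm_nonneg u, norm_nonneg z]
    exact le_of_sq_le_sq (by linarith) (norm_nonneg _)
  · intro z hz
    have hz1 : ‖z‖ = 1 := by simpa using hz
    rw [hk]
    have h := norm_sq_sub u z
    rw [hz1] at h
    have h2 : ‖z - u‖ ^ 2 = ‖1 - (starRingEnd ℂ) u * z‖ ^ 2 := by linarith
    exact (sq_eq_sq₀ (norm_nonneg _) (norm_nonneg _)).1 h2

lemma SqDom.nonvanishing {g : ℂ → ℂ} (hg : AnalyticOnNhd ℂ g (closedBall 0 1))
    (h0 : ∀ z ∈ closedBall (0:ℂ) 1, g z ≠ 0) : SqDom g := by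
  have hopen : IsOpen {z | AnalyticAt ℂ g z ∧ g z ≠ 0} := by
    rw [isOpen_iff_mem_nhds]
    rintro z ⟨h1, h2⟩
    filter_upwards [h1.eventually_analyticAt, h1.continuousAt.eventually_ne h2] with w a b
    exact ⟨a, b⟩
  obtain ⟨e, he, hsub⟩ := (isCompact_closedBall (0:ℂ) 1).exists_thickening_subset_open hopen
    (fun z hz => ⟨hg z hz, h0 z hz⟩)
  rw [thickening_closedBall he zero_le_one] at hsub
  have hd : DifferentiableOn ℂ (fun z => deriv g z / g z) (ball 0 (e + 1)) := by
    intro z hz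
    have := hsub hz
    exact (this.1.deriv.differentiableAt.div this.1.differentiableAt this.2).differentiableWithinAt
  obtain ⟨L, hL⟩ := hd.isExactOn_ball
  have h0m : (0:ℂ) ∈ ball (0:ℂ) (e + 1) := by simp; linarith
  -- `g * exp (-L)` is constant
  have hconst : ∀ z ∈ ball (0:ℂ) (e + 1), g z * exp (-L z) = g 0 * exp (-L 0) := by
    intro z hz
    refine (convex_ball (0:ℂ) (e + 1)).is_const_of_fderivWithin_eq_zero (𝕜 := ℂ)
      (f := fun z => g z * exp (-L z)) ?_ ?_ hz h0m
    · intro w hw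
      have := hsub hw
      exact (this.1.differentiableAt.mul
        ((hL w hw).differentiableAt.neg.cexp)).differentiableWithinAt
    · intro w hw
      have := hsub hw
      rw [fderivWithin_of_isOpen isOpen_ball hw]
      have hD : HasDerivAt (fun z => g z * exp (-L z)) 0 w := by
        have := this.1.differentiableAt.hasDerivAt.mul ((hL w hw).neg.cexp)
        convert! this using 1
        have h2 := (hsub hw).2
        field_simp
        ring
      have := hD.hasFDerivAt.fderiv
      rw [this]; ext; simp
  have hg0 : g 0 ≠ 0 := h0 0 (by simp)
  set c : ℂ := Complex.log (g 0 * exp (-L 0)) with hc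
  have hgz : ∀ z ∈ ball (0:ℂ) (e + 1), g z = exp (c + L z) := by
    intro z hz
    rw [exp_add, hc, Complex.exp_log (by simp [hg0]), ← hconst z hz, mul_assoc, ← exp_add]
    simp
  have hsub2 : closedBall (0:ℂ) 1 ⊆ ball 0 (e + 1) := closedBall_subset_ball (by linarith)
  have hk : ∀ z ∈ closedBall (0:ℂ) 1, ‖g z‖ = ‖exp ((c + L z) / 2)‖ ^ 2 := by
    intro z hz
    rw [hgz z (hsub2 hz), ← norm_pow, ← Complex.exp_nat_mul]
    congr 2; push_cast; ring
  refine ⟨fun z => exp ((c + L z) / 2), ?_, fun z hz => (hk z hz).le,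
    fun z hz => hk z (sphere_subset_closedBall hz)⟩
  apply DifferentiableOn.diffContOnCl
  rw [closure_ball _ one_ne_zero]
  intro z hz
  exact ((((hL z (hsub2 hz)).differentiableAt.const_add c).div_const 2).cexp).differentiableWithinAt

lemma SqDom.analytic {F : ℂ → ℂ} (hF : AnalyticOnNhd ℂ F (closedBall 0 1)) : SqDom F := by
  have hpre : IsPreconnected (closedBall (0:ℂ) 1) := (convex_closedBall (0:ℂ) 1).isPreconnected
  by_cases hz : EqOn F 0 (closedBall 0 1)
  · refine ⟨fun _ => 0, diffContOnCl_const, fun z h => ?_, fun z h => ?_⟩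
    · simp [hz h]
    · simp [hz (sphere_subset_closedBall h)]
  have hord : ∀ u : closedBall (0:ℂ) 1, meromorphicOrderAt F u ≠ ⊤ := by
    rintro ⟨u, hu⟩ htop
    apply hz
    rw [meromorphicOrderAt_eq_top_iff] at htop
    exact hF.eqOn_of_preconnected_of_frequently_eq (g := 0) (fun _ _ => analyticAt_const) hpre hu
      htop.frequently
  have hfin : (MeromorphicOn.divisor F (closedBall 0 1)).support.Finite :=
    (MeromorphicOn.divisor F (closedBall 0 1)).finiteSupport (isCompact_closedBall 0 1)
  obtain ⟨g, g1, g2, g3⟩ := hF.meromorphicOn.extract_zeros_poles hord hfin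
  set D := MeromorphicOn.divisor F (closedBall (0:ℂ) 1) with hD
  have hD0 : 0 ≤ D := MeromorphicOn.AnalyticOnNhd.divisor_nonneg hF
  set G : ℂ → ℂ := fun z => (∏ u ∈ hfin.toFinset, (z - u) ^ (D u).toNat) * g z with hG
  have hprod : ((∏ᶠ u, (· - u) ^ D u) • g : ℂ → ℂ) = G := by
    rw [finprod_eq_prod_of_mulSupport_subset (s := hfin.toFinset)]
    · ext z
      simp only [hG, Pi.smul_apply', Finset.prod_apply, smul_eq_mul, Pi.pow_apply]
      congr 1
      apply Finset.prod_congr rfl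
      intro u _
      rw [← zpow_natCast, Int.toNat_of_nonneg (hD0 u)]
    · intro u hu
      simp only [Finite.coe_toFinset, Function.mem_support]
      intro h
      apply hu
      ext z; simp [h]
  rw [hprod] at g3
  have hGa : AnalyticOnNhd ℂ G (closedBall 0 1) := by
    intro z hz
    have := g1 z hz
    have h2 : AnalyticAt ℂ (fun z => ∏ u ∈ hfin.toFinset, (z - u) ^ (D u).toNat) z := by
      apply Finset.analyticAt_fun_prod
      intro u _
      fun_prop
    exact h2.mul this
  have hfreq : ∃ᶠ z in nhdsWithin (0:ℂ) {0}ᶜ, F z = G z := by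
    apply Filter.Eventually.frequently
    have h1 : ∀ᶠ z in Filter.codiscreteWithin (closedBall (0:ℂ) 1), F z = G z := g3
    have h2 := mem_codiscreteWithin_iff_forall_mem_nhdsNE.1 h1 0 (by simp)
    have h3 : closedBall (0:ℂ) 1 ∈ nhdsWithin (0:ℂ) {0}ᶜ :=
      nhdsWithin_le_nhds (closedBall_mem_nhds 0 one_pos)
    filter_upwards [h2, h3] with z a b
    rcases a with a | a
    · exact a
    · exact absurd b a
  have hEq : EqOn F G (closedBall 0 1) :=
    hF.eqOn_of_preconnected_of_frequently_eq hGa hpre (by simp) hfreq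
  have hS : SqDom G := by
    apply SqDom.mul
    · apply SqDom.prod
      intro u hu
      apply SqDom.pow
      apply SqDom.linear
      have : u ∈ closedBall (0:ℂ) 1 := D.supportWithinDomain (by simpa using hu)
      simpa using this
    · exact SqDom.nonvanishing g1 (fun z hz => g2 ⟨z, hz⟩)
  obtain ⟨k, k1, k2, k3⟩ := hS
  refine ⟨k, k1, fun z h => ?_, fun z h => ?_⟩
  · rw [hEq h]; exact k2 z h
  · rw [hEq (sphere_subset_closedBall h)]; exact k3 z h

lemma pk_cont {a : ℂ} (ha : ‖a‖ < 1) : ContinuousOn (poissonKernel 0 a) (sphere (0:ℂ) 1) := by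
  unfold poissonKernel
  apply ContinuousOn.div (by fun_prop) (by fun_prop)
  intro z hz
  have : ‖z‖ = 1 := by simpa using hz
  have h2 : z - 0 - (a - 0) ≠ 0 := by
    intro h
    have : z = a := by simpa [sub_eq_zero] using h
    subst this; linarith
  positivity

lemma pk_nonneg {a z : ℂ} (ha : ‖a‖ < 1) (hz : ‖z‖ = 1) : 0 ≤ poissonKernel 0 a z := by
  unfold poissonKernel
  simp only [sub_zero, hz]
  have : ‖a‖ ^ 2 ≤ 1 := by nlinarith [norm_nonneg a]
  apply div_nonneg (by linarith) (by positivity)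

lemma sqrt_subharm {F : ℂ → ℂ} (hF : AnalyticOnNhd ℂ F (closedBall 0 1)) {a : ℂ} (ha : ‖a‖ < 1) :
    √‖F a‖ ≤ ∫ ζ, poissonKernel 0 a ζ * √‖F ζ‖ ∂circleMeasure := by
  obtain ⟨k, k1, k2, k3⟩ := SqDom.analytic hF
  have ham : a ∈ ball (0:ℂ) 1 := by simpa using ha
  have hkc : ContinuousOn k (sphere (0:ℂ) 1) := k1.2.mono (by
    rw [closure_ball _ one_ne_zero]; exact sphere_subset_closedBall)
  have h1 := k1.circleAverage_poissonKernel_smul ham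
  have hcont : ContinuousOn (poissonKernel 0 a • k) (sphere (0:ℂ) 1) := (pk_cont ha).smul hkc
  rw [← cm_integral hcont] at h1
  calc √‖F a‖ ≤ ‖k a‖ := by
        rw [Real.sqrt_le_left (norm_nonneg _)]
        exact k2 a (ball_subset_closedBall ham)
    _ ≤ ∫ ζ, ‖(poissonKernel 0 a • k) ζ‖ ∂circleMeasure := by
        rw [← h1]; exact norm_integral_le_integral_norm _
    _ = _ := by
        apply integral_congr_ae
        filter_upwards [cm_ae_norm] with ζ hζ
        rw [Pi.smul_apply', norm_smul, Real.norm_of_nonneg (pk_nonneg ha hζ),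
          k3 ζ (by simpa using hζ), Real.sqrt_sq (norm_nonneg _)]


noncomputable def rad (k : ℕ) : ℝ := 1 - 1 / ((k:ℝ) + 2)

lemma rad_mem (k : ℕ) : rad k ∈ Ioo (0:ℝ) 1 := by
  unfold rad
  have h : (0:ℝ) < 1 / ((k:ℝ) + 2) := by positivity
  have h2 : 1 / ((k:ℝ) + 2) < 1 := by
    rw [div_lt_one (by positivity)]
    have : (0:ℝ) ≤ k := Nat.cast_nonneg k
    linarith
  constructor <;> linarith

lemma rad_tend : Filter.Tendsto rad Filter.atTop (nhdsWithin 1 (Iio 1)) := by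
  apply tendsto_nhdsWithin_of_tendsto_nhds_of_eventually_within
  · have h : Filter.Tendsto (fun k : ℕ => 1 / ((k:ℝ) + 2)) Filter.atTop (nhds 0) := by
      apply Filter.Tendsto.const_div_atTop
      exact Filter.tendsto_atTop_add_const_right _ _ tendsto_natCast_atTop_atTop
    have := h.const_sub 1
    rw [sub_zero] at this
    exact this
  · exact Filter.Eventually.of_forall fun k => (rad_mem k).2

lemma rad_map {r : ℝ} (h0 : 0 < r) (h1 : r < 1) {z : ℂ} (hz : ‖z‖ ≤ 1) :
    (r:ℂ) * z ∈ ball (0:ℂ) 1 := by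
  simp only [mem_ball, dist_zero_right, norm_mul, Complex.norm_real, Real.norm_of_nonneg h0.le]
  nlinarith [norm_nonneg z]

lemma dil_analytic {h : ℂ → ℂ} (hh : DifferentiableOn ℂ h (ball (0:ℂ) 1)) {r : ℝ}
    (h0 : 0 < r) (h1 : r < 1) : AnalyticOnNhd ℂ (fun z => h (r * z)) (closedBall 0 1) := by
  intro z hz
  have hz1 : ‖z‖ ≤ 1 := by simpa using hz
  have h2 : AnalyticAt ℂ h (r * z) := hh.analyticAt (isOpen_ball.mem_nhds (rad_map h0 h1 hz1))
  exact h2.fun_comp (by fun_prop)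

lemma dil_cont {h : ℂ → ℂ} (hh : DifferentiableOn ℂ h (ball (0:ℂ) 1)) {r : ℝ}
    (h0 : 0 < r) (h1 : r < 1) : ContinuousOn (fun z => h (r * z)) (sphere (0:ℂ) 1) :=
  (dil_analytic hh h0 h1).continuousOn.mono sphere_subset_closedBall

lemma pk_integral {a : ℂ} (ha : ‖a‖ < 1) : ∫ ζ, poissonKernel 0 a ζ ∂circleMeasure = 1 := by
  rw [cm_integral (pk_cont ha)]
  have ham : a ∈ ball (0:ℂ) 1 := by simpa using ha
  have h1 := (diffContOnCl_const (𝕜 := ℂ) (c := (1:ℂ)) (s := ball (0:ℂ) 1)).circleAverage_poissonKernel_smul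
    ham
  have hc : ContinuousOn (poissonKernel 0 a • fun _ => (1:ℂ)) (sphere (0:ℂ) 1) :=
    (pk_cont ha).smul continuousOn_const
  rw [← cm_integral hc] at h1
  rw [← cm_integral (pk_cont ha)]
  have h2 : ∫ ζ, (poissonKernel 0 a • fun _ => (1:ℂ)) ζ ∂circleMeasure
      = ((∫ ζ, poissonKernel 0 a ζ ∂circleMeasure : ℝ) : ℂ) := by
    rw [← integral_complex_ofReal]
    congr 1; ext ζ; simp
  rw [h2] at h1
  exact_mod_cast h1

lemma hardy_integral {h : ℂ → ℂ} (hh : DifferentiableOn ℂ h (ball (0:ℂ) 1))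
    (hfin : hardyNorm 1 h ≠ ⊤) {r : ℝ} (h0 : 0 < r) (h1 : r < 1) :
    ∫ ζ, ‖h (r * ζ)‖ ∂circleMeasure ≤ (hardyNorm 1 h).toReal := by
  have hi : Integrable (fun ζ => ‖h (r * ζ)‖) circleMeasure := (cm_integrable (dil_cont hh h0 h1)).norm
  rw [← ENNReal.ofReal_le_iff_le_toReal hfin,
    ofReal_integral_eq_lintegral_ofReal hi (Filter.Eventually.of_forall fun _ => norm_nonneg _)]
  unfold hardyNorm
  refine le_trans (le_of_eq ?_) (le_iSup₂ (f := fun r (_ : r ∈ Set.Ioo (0 : ℝ) 1) =>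
    ∫⁻ ζ, ENNReal.ofReal (‖h (↑r * ζ)‖ ^ (1:ℝ)) ∂circleMeasure) r ⟨h0, h1⟩)
  simp only [Real.rpow_one]

section H1

lemma bd_tend {h hs : ℂ → ℂ} (hb : IsBoundaryFn h hs) : ∀ᵐ ζ ∂circleMeasure,
    Filter.Tendsto (fun k => h (rad k * ζ)) Filter.atTop (nhds (hs ζ)) := by
  filter_upwards [hb] with ζ hζ
  exact hζ.comp rad_tend

lemma bd_aesm {h hs : ℂ → ℂ} (hh : DifferentiableOn ℂ h (ball (0:ℂ) 1)) (hb : IsBoundaryFn h hs) : AEStronglyMeasurable hs circleMeasure :=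
  aestronglyMeasurable_of_tendsto_ae Filter.atTop
    (fun k => cm_aesm (dil_cont hh (rad_mem k).1 (rad_mem k).2)) (bd_tend hb)

lemma bd_fatou {h hs : ℂ → ℂ} (hh : DifferentiableOn ℂ h (ball (0:ℂ) 1)) (hb : IsBoundaryFn h hs) : ∫⁻ ζ, ENNReal.ofReal ‖hs ζ‖ ∂circleMeasure ≤ hardyNorm 1 h := by
  have hm : ∀ k : ℕ, AEMeasurable (fun ζ => ENNReal.ofReal ‖h (rad k * ζ)‖) circleMeasure := fun k =>
    (cm_aesm (dil_cont hh (rad_mem k).1 (rad_mem k).2)).norm.aemeasurable.ennreal_ofReal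
  have h1 := lintegral_liminf_le' (u := Filter.atTop) hm
  have h2 : ∫⁻ ζ, ENNReal.ofReal ‖hs ζ‖ ∂circleMeasure
      = ∫⁻ ζ, Filter.liminf (fun k => ENNReal.ofReal ‖h (rad k * ζ)‖) Filter.atTop ∂circleMeasure := by
    apply lintegral_congr_ae
    filter_upwards [bd_tend hb] with ζ hζ
    exact ((ENNReal.continuous_ofReal.tendsto _).comp hζ.norm).liminf_eq.symm
  rw [h2]
  refine h1.trans ?_
  refine (Filter.liminf_le_of_frequently_le' (Filter.Frequently.of_forall fun k => ?_))
  unfold hardyNorm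
  refine le_trans (le_of_eq ?_) (le_iSup₂ (f := fun r (_ : r ∈ Set.Ioo (0 : ℝ) 1) =>
    ∫⁻ ζ, ENNReal.ofReal (‖h (↑r * ζ)‖ ^ (1:ℝ)) ∂circleMeasure) (rad k) (rad_mem k))
  simp only [Real.rpow_one]

lemma pk_bdd {a : ℂ} (ha : ‖a‖ < 1) : ∃ B, 0 ≤ B ∧ ∀ ζ, ‖ζ‖ = 1 → poissonKernel 0 a ζ ≤ B := by
  obtain ⟨B, hB⟩ := (isCompact_sphere (0:ℂ) 1).exists_bound_of_continuousOn (pk_cont ha)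
  refine ⟨B, (norm_nonneg _).trans (hB 1 (by simp)), fun ζ hζ => ?_⟩
  exact (le_abs_self _).trans (hB ζ (by simpa using hζ))

lemma pk_mul_integrable {a : ℂ} (ha : ‖a‖ < 1) {s : ℂ → ℝ} (hs : Integrable s circleMeasure) :
    Integrable (fun ζ => poissonKernel 0 a ζ * s ζ) circleMeasure := by
  obtain ⟨B, _, hB⟩ := pk_bdd ha
  refine hs.bdd_mul (c := B) (cm_aesm (pk_cont ha)) ?_
  filter_upwards [cm_ae_norm] with ζ hζ
  rw [Real.norm_of_nonneg (pk_nonneg ha hζ)]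
  exact hB ζ hζ

lemma integrable_sqrt {s : ℂ → ℂ} (hs : Integrable s circleMeasure) :
    Integrable (fun ζ => √‖s ζ‖) circleMeasure := by
  refine (hs.norm.add (integrable_const (1:ℝ))).mono' ?_ ?_
  · exact Real.continuous_sqrt.comp_aestronglyMeasurable hs.1.norm
  · refine Filter.Eventually.of_forall fun ζ => ?_
    rw [Real.norm_of_nonneg (Real.sqrt_nonneg _)]
    have := Real.sq_sqrt (norm_nonneg (s ζ))
    simp only [Pi.add_apply]
    nlinarith [sq_nonneg (√‖s ζ‖ - 1), Real.sqrt_nonneg ‖s ζ‖]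

lemma sqrt_bd {h hs : ℂ → ℂ} (hh : DifferentiableOn ℂ h (ball (0:ℂ) 1)) (hb : IsBoundaryFn h hs) (hfin : hardyNorm 1 h ≠ ⊤) (hi : Integrable hs circleMeasure)
    {a : ℂ} (ha : ‖a‖ < 1) :
    √‖h a‖ ≤ ∫ ζ, poissonKernel 0 a ζ * √‖hs ζ‖ ∂circleMeasure := by
  obtain ⟨B, hB0, hB⟩ := pk_bdd ha
  set A := (hardyNorm 1 h).toReal with hA
  have hA0 : 0 ≤ A := ENNReal.toReal_nonneg
  have hik : ∀ k, Integrable (fun ζ => h (rad k * ζ)) circleMeasure := fun k =>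
    cm_integrable (dil_cont hh (rad_mem k).1 (rad_mem k).2)
  have key : ∀ K : ℝ, 0 < K →
      √‖h a‖ ≤ (∫ ζ, poissonKernel 0 a ζ * √‖hs ζ‖ ∂circleMeasure) + B * A / K := by
    intro K hK
    have hIntg : ∀ s : ℂ → ℂ, Integrable s circleMeasure →
        Integrable (fun ζ => poissonKernel 0 a ζ * min (√‖s ζ‖) K) circleMeasure := by
      intro s hs
      exact pk_mul_integrable ha ((integrable_sqrt hs).inf (integrable_const K))
    have h1 : ∀ k, √‖h (rad k * a)‖ ≤
        (∫ ζ, poissonKernel 0 a ζ * min (√‖h (rad k * ζ)‖) K ∂circleMeasure) + B * A / K := by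
      intro k
      have e1 := sqrt_subharm (dil_analytic hh (rad_mem k).1 (rad_mem k).2) ha
      refine e1.trans ?_
      have e2 : ∫ ζ, poissonKernel 0 a ζ * √‖h (rad k * ζ)‖ ∂circleMeasure ≤
          ∫ ζ, (poissonKernel 0 a ζ * min (√‖h (rad k * ζ)‖) K + B / K * ‖h (rad k * ζ)‖)
            ∂circleMeasure := by
        apply integral_mono_ae (pk_mul_integrable ha (integrable_sqrt (hik k)))
          ((hIntg _ (hik k)).add ((hik k).norm.const_mul _))
        filter_upwards [cm_ae_norm] with ζ hζ
        have p0 := pk_nonneg ha hζ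
        have p1 := hB ζ hζ
        set s := √‖h (rad k * ζ)‖ with hs
        have hs0 : 0 ≤ s := Real.sqrt_nonneg _
        have hs2 : ‖h (rad k * ζ)‖ = s ^ 2 := (Real.sq_sqrt (norm_nonneg _)).symm
        have hle : s ≤ min s K + s ^ 2 / K := by
          rcases le_total s K with hsK | hsK
          · rw [min_eq_left hsK]
            have : 0 ≤ s ^ 2 / K := by positivity
            linarith
          · have : s ≤ s ^ 2 / K := by
              rw [le_div_iff₀ hK]; nlinarith
            have : 0 ≤ min s K := le_min hs0 hK.le
            linarith
        change poissonKernel 0 a ζ * s ≤ poissonKernel 0 a ζ * min s K + B / K * ‖h (rad k * ζ)‖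
        rw [hs2]
        calc poissonKernel 0 a ζ * s ≤ poissonKernel 0 a ζ * (min s K + s ^ 2 / K) := by gcongr
          _ = poissonKernel 0 a ζ * min s K + poissonKernel 0 a ζ * (s ^ 2 / K) := by ring
          _ ≤ poissonKernel 0 a ζ * min s K + B * (s ^ 2 / K) := by gcongr
          _ = _ := by ring
      refine e2.trans ?_
      rw [integral_add (hIntg _ (hik k)) ((hik k).norm.const_mul _), integral_const_mul]
      have e3 := hardy_integral hh hfin (rad_mem k).1 (rad_mem k).2
      have : B / K * ∫ ζ, ‖h (rad k * ζ)‖ ∂circleMeasure ≤ B / K * A := by gcongr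
      have e4 : B / K * A = B * A / K := by ring
      linarith
    have h2 : Filter.Tendsto (fun k => √‖h (rad k * a)‖) Filter.atTop (nhds (√‖h a‖)) := by
      apply Filter.Tendsto.sqrt
      apply Filter.Tendsto.norm
      have hc : ContinuousAt h a := (hh.differentiableAt (isOpen_ball.mem_nhds (by simpa using ha))).continuousAt
      apply hc.tendsto.comp
      have : Filter.Tendsto rad Filter.atTop (nhds 1) := rad_tend.mono_right nhdsWithin_le_nhds
      have := ((Complex.continuous_ofReal.tendsto _).comp this).mul_const a
      simpa using this
    have h3 : Filter.Tendsto (fun k => (∫ ζ, poissonKernel 0 a ζ * min (√‖h (rad k * ζ)‖) K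
        ∂circleMeasure)) Filter.atTop
        (nhds (∫ ζ, poissonKernel 0 a ζ * min (√‖hs ζ‖) K ∂circleMeasure)) := by
      apply tendsto_integral_of_dominated_convergence (fun _ => B * K)
      · exact fun k => (hIntg _ (hik k)).1
      · exact integrable_const _
      · intro k
        filter_upwards [cm_ae_norm] with ζ hζ
        have p0 := pk_nonneg ha hζ
        have p1 := hB ζ hζ
        have : 0 ≤ min (√‖h (rad k * ζ)‖) K := le_min (Real.sqrt_nonneg _) hK.le
        rw [Real.norm_of_nonneg (mul_nonneg p0 this)]
        exact mul_le_mul p1 (min_le_right _ _) this hB0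
      · filter_upwards [bd_tend hb] with ζ hζ
        exact (hζ.norm.sqrt.min tendsto_const_nhds).const_mul _
    have h4 := le_of_tendsto_of_tendsto' h2 (h3.add_const _) h1
    refine h4.trans ?_
    gcongr ?_ + _
    apply integral_mono_ae (hIntg _ hi) (pk_mul_integrable ha (integrable_sqrt hi))
    filter_upwards [cm_ae_norm] with ζ hζ
    exact mul_le_mul_of_nonneg_left (min_le_left _ _) (pk_nonneg ha hζ)
  have hlim : Filter.Tendsto (fun K : ℝ => (∫ ζ, poissonKernel 0 a ζ * √‖hs ζ‖ ∂circleMeasure)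
      + B * A / K) Filter.atTop (nhds ((∫ ζ, poissonKernel 0 a ζ * √‖hs ζ‖ ∂circleMeasure) + 0)) := by
    apply Filter.Tendsto.const_add
    exact Filter.Tendsto.const_div_atTop Filter.tendsto_id _
  rw [add_zero] at hlim
  refine ge_of_tendsto hlim ?_
  filter_upwards [Filter.eventually_gt_atTop 0] with K hK using key K hK

lemma pk_bd {h hs : ℂ → ℂ} (hh : DifferentiableOn ℂ h (ball (0:ℂ) 1)) (hb : IsBoundaryFn h hs) (hfin : hardyNorm 1 h ≠ ⊤) (hi : Integrable hs circleMeasure)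
    {a : ℂ} (ha : ‖a‖ < 1) :
    ‖h a‖ ≤ ∫ ζ, poissonKernel 0 a ζ * ‖hs ζ‖ ∂circleMeasure := by
  have h1 := sqrt_bd hh hb hfin hi ha
  set t := ∫ ζ, poissonKernel 0 a ζ * √‖hs ζ‖ ∂circleMeasure with ht
  have i0 := pk_mul_integrable ha hi.norm
  have i1 := pk_mul_integrable ha (integrable_sqrt hi)
  have i2 : Integrable (fun ζ => poissonKernel 0 a ζ) circleMeasure := cm_integrable (pk_cont ha)
  have h2 : ∫ ζ, (2 * t * (poissonKernel 0 a ζ * √‖hs ζ‖) - t ^ 2 * poissonKernel 0 a ζ) ∂circleMeasure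
      ≤ ∫ ζ, poissonKernel 0 a ζ * ‖hs ζ‖ ∂circleMeasure := by
    apply integral_mono_ae ((i1.const_mul _).sub (i2.const_mul _)) i0
    filter_upwards [cm_ae_norm] with ζ hζ
    have p0 := pk_nonneg ha hζ
    have hs2 := Real.sq_sqrt (norm_nonneg (hs ζ))
    change 2 * t * (poissonKernel 0 a ζ * √‖hs ζ‖) - t ^ 2 * poissonKernel 0 a ζ ≤ _
    nlinarith [mul_nonneg p0 (sq_nonneg (√‖hs ζ‖ - t))]
  rw [integral_sub (i1.const_mul _) (i2.const_mul _), integral_const_mul, integral_const_mul,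
    pk_integral ha, ← ht] at h2
  have h3 := Real.sq_sqrt (norm_nonneg (h a))
  have h4 := Real.sqrt_nonneg ‖h a‖
  nlinarith

lemma pk_symm {r : ℝ} {ζ η : ℂ} (hζ : ‖ζ‖ = 1) (hη : ‖η‖ = 1) :
    poissonKernel 0 (r * η) ζ = poissonKernel 0 (r * ζ) η := by
  have hz : ζ.re * ζ.re + ζ.im * ζ.im = 1 := by
    rw [← Complex.normSq_apply, Complex.normSq_eq_norm_sq, hζ]; norm_num
  have hn : η.re * η.re + η.im * η.im = 1 := by
    rw [← Complex.normSq_apply, Complex.normSq_eq_norm_sq, hη]; norm_num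
  have : ‖ζ - r * η‖ ^ 2 = ‖η - r * ζ‖ ^ 2 := by
    simp only [← Complex.normSq_eq_norm_sq, Complex.normSq_apply]
    simp
    linear_combination (1 - r ^ 2) * hz - (1 - r ^ 2) * hn
  unfold poissonKernel
  simp only [sub_zero, norm_mul, hζ, hη, this]

lemma int_bd {h hs : ℂ → ℂ} (hh : DifferentiableOn ℂ h (ball (0:ℂ) 1)) (hb : IsBoundaryFn h hs) (hfin : hardyNorm 1 h ≠ ⊤) (hi : Integrable hs circleMeasure) {r : ℝ}
    (h0 : 0 < r) (h1 : r < 1) :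
    ∫ ζ, ‖h (r * ζ)‖ ∂circleMeasure ≤ ∫ ζ, ‖hs ζ‖ ∂circleMeasure := by
  have hnorm : ∀ η : ℂ, ‖η‖ = 1 → ‖(r:ℂ) * η‖ < 1 := by
    intro η hη
    simpa using rad_map h0 h1 hη.le
  have hir : Integrable (fun ζ => h (r * ζ)) circleMeasure := cm_integrable (dil_cont hh h0 h1)
  rw [← ENNReal.ofReal_le_ofReal_iff (integral_nonneg fun _ => norm_nonneg _),
    ofReal_integral_eq_lintegral_ofReal hir.norm (Filter.Eventually.of_forall fun _ => norm_nonneg _),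
    ofReal_integral_eq_lintegral_ofReal hi.norm (Filter.Eventually.of_forall fun _ => norm_nonneg _)]
  have hm : Measurable (fun p : ℂ × ℂ => ENNReal.ofReal (poissonKernel 0 (r * p.1) p.2)) := by
    unfold poissonKernel
    fun_prop
  calc ∫⁻ η, ENNReal.ofReal ‖h (r * η)‖ ∂circleMeasure
      ≤ ∫⁻ η, ∫⁻ ζ, ENNReal.ofReal (poissonKernel 0 (r * η) ζ) * ENNReal.ofReal ‖hs ζ‖
          ∂circleMeasure ∂circleMeasure := by
        apply lintegral_mono_ae
        filter_upwards [cm_ae_norm] with η hη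
        have e1 := pk_bd hh hb hfin hi (hnorm η hη)
        refine (ENNReal.ofReal_le_ofReal e1).trans (le_of_eq ?_)
        rw [ofReal_integral_eq_lintegral_ofReal (pk_mul_integrable (hnorm η hη) hi.norm)]
        · apply lintegral_congr_ae
          filter_upwards [cm_ae_norm] with ζ hζ
          rw [ENNReal.ofReal_mul (pk_nonneg (hnorm η hη) hζ)]
        · filter_upwards [cm_ae_norm] with ζ hζ
          exact mul_nonneg (pk_nonneg (hnorm η hη) hζ) (norm_nonneg _)
    _ = ∫⁻ ζ, ∫⁻ η, ENNReal.ofReal (poissonKernel 0 (r * η) ζ) * ENNReal.ofReal ‖hs ζ‖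
          ∂circleMeasure ∂circleMeasure := by
        apply lintegral_lintegral_swap
        exact hm.aemeasurable.mul (hi.1.norm.aemeasurable.ennreal_ofReal.comp_snd)
    _ = ∫⁻ ζ, ENNReal.ofReal ‖hs ζ‖ ∂circleMeasure := by
        apply lintegral_congr_ae
        filter_upwards [cm_ae_norm] with ζ hζ
        have e2 : ∫⁻ η, ENNReal.ofReal (poissonKernel 0 (r * η) ζ) ∂circleMeasure = 1 := by
          rw [← ENNReal.ofReal_one, ← pk_integral (hnorm ζ hζ),
            ofReal_integral_eq_lintegral_ofReal (cm_integrable (pk_cont (hnorm ζ hζ)))]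
          · apply lintegral_congr_ae
            filter_upwards [cm_ae_norm] with η hη
            rw [pk_symm hζ hη]
          · filter_upwards [cm_ae_norm] with η hη
            exact pk_nonneg (hnorm ζ hζ) hη
        have hm2 : Measurable (fun η : ℂ => ENNReal.ofReal (poissonKernel 0 (r * η) ζ)) := by
          unfold poissonKernel
          fun_prop
        rw [lintegral_mul_const _ hm2, e2, one_mul]

lemma L1_conv {h hs : ℂ → ℂ} (hh : DifferentiableOn ℂ h (ball (0:ℂ) 1)) (hb : IsBoundaryFn h hs) (hfin : hardyNorm 1 h ≠ ⊤) (hi : Integrable hs circleMeasure) :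
    Filter.Tendsto (fun k => ∫ ζ, ‖h (rad k * ζ) - hs ζ‖ ∂circleMeasure) Filter.atTop (nhds 0) := by
  have hik : ∀ k, Integrable (fun ζ => h (rad k * ζ)) circleMeasure := fun k =>
    cm_integrable (dil_cont hh (rad_mem k).1 (rad_mem k).2)
  have h1 : Filter.Tendsto (fun k => ∫ ζ, (‖hs ζ‖ + ‖h (rad k * ζ) - hs ζ‖ - ‖h (rad k * ζ)‖)
      ∂circleMeasure) Filter.atTop (nhds (∫ ζ, (0:ℝ) ∂circleMeasure)) := by
    apply tendsto_integral_of_dominated_convergence (fun ζ => 2 * ‖hs ζ‖)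
    · intro k
      exact ((hi.norm.add ((hik k).sub hi).norm).sub (hik k).norm).1
    · exact hi.norm.const_mul _
    · intro k
      refine Filter.Eventually.of_forall fun ζ => ?_
      rw [Real.norm_eq_abs, abs_le]
      have a1 := norm_sub_le (h (rad k * ζ)) (hs ζ)
      have a2 := norm_sub_norm_le (h (rad k * ζ)) (hs ζ)
      have a3 := norm_nonneg (hs ζ)
      constructor <;> linarith
    · filter_upwards [bd_tend hb] with ζ hζ
      have := ((hζ.sub_const (hs ζ)).norm.const_add ‖hs ζ‖).sub hζ.norm
      simpa using this
  rw [integral_zero] at h1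
  refine squeeze_zero (fun k => integral_nonneg fun _ => norm_nonneg _) (fun k => ?_) h1
  have j1 : Integrable (fun ζ => ‖h (rad k * ζ) - hs ζ‖) circleMeasure := ((hik k).sub hi).norm
  have j2 : Integrable (fun ζ => ‖hs ζ‖ + ‖h (rad k * ζ) - hs ζ‖) circleMeasure := hi.norm.add j1
  rw [integral_sub j2 (hik k).norm, integral_add hi.norm j1]
  have := int_bd hh hb hfin hi (rad_mem k).1 (rad_mem k).2
  linarith

lemma den_le {z ζ : ℂ} (hζ : ‖ζ‖ = 1) : 1 - ‖z‖ ≤ ‖1 - (starRingEnd ℂ) ζ * z‖ := by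
  have := norm_sub_norm_le 1 ((starRingEnd ℂ) ζ * z)
  rw [norm_mul, RCLike.norm_conj, hζ, one_mul, norm_one] at this
  exact this

lemma den_cont (z : ℂ) : Continuous (fun ζ : ℂ => 1 - (starRingEnd ℂ) ζ * z) := by
  have : Continuous (fun ζ : ℂ => (starRingEnd ℂ) ζ) := Complex.continuous_conj
  fun_prop

lemma div_den_integrable {z : ℂ} (hz : ‖z‖ < 1) {s : ℂ → ℂ} (hs : Integrable s circleMeasure) :
    Integrable (fun ζ => s ζ / (1 - (starRingEnd ℂ) ζ * z)) circleMeasure := by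
  have : Integrable (fun ζ => (1 - (starRingEnd ℂ) ζ * z)⁻¹ * s ζ) circleMeasure := by
    refine hs.bdd_mul (c := (1 - ‖z‖)⁻¹) (den_cont z).measurable.inv.aestronglyMeasurable ?_
    filter_upwards [cm_ae_norm] with ζ hζ
    rw [norm_inv]
    exact inv_anti₀ (by linarith) (den_le hζ)
  refine this.congr (Filter.Eventually.of_forall fun ζ => ?_)
  simp only [div_eq_mul_inv, mul_comm]

lemma cauchy_dil {F : ℂ → ℂ} (hF : AnalyticOnNhd ℂ F (closedBall 0 1)) {z : ℂ} (hz : ‖z‖ < 1) :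
    ∫ ζ, F ζ / (1 - (starRingEnd ℂ) ζ * z) ∂circleMeasure = F z := by
  have hd : DiffContOnCl ℂ F (ball 0 1) := by
    apply DifferentiableOn.diffContOnCl
    rw [closure_ball _ one_ne_zero]
    exact hF.differentiableOn
  have hne : ∀ ζ ∈ sphere (0:ℂ) 1, ζ - z ≠ 0 := by
    intro ζ hζ h
    have h1 : ‖ζ‖ = 1 := by simpa using hζ
    rw [sub_eq_zero] at h
    subst h; linarith
  have h1 := DiffContOnCl.circleAverage_smul_div (c := 0) (R := 1) (w := z) (by simpa using hd)
    (by simpa using hz)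
  rw [← h1, ← cm_integral]
  · apply integral_congr_ae
    filter_upwards [cm_ae_norm] with ζ hζ
    have h2 := hne ζ (by simpa using hζ)
    have h3 : ζ * (starRingEnd ℂ) ζ = 1 := by
      rw [Complex.mul_conj, Complex.normSq_eq_norm_sq, hζ]; simp
    have h4 : ζ * (1 - (starRingEnd ℂ) ζ * z) = ζ - z := by
      linear_combination -z * h3
    have h5 : ζ ≠ 0 := by intro h; simp [h] at hζ
    have h6 : 1 - (starRingEnd ℂ) ζ * z ≠ 0 := by
      intro h; rw [h, mul_zero] at h4; exact h2 h4.symm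
    rw [sub_zero, smul_eq_mul, ← h4]
    field_simp
  · apply ContinuousOn.fun_smul
    · exact ContinuousOn.div (by fun_prop) (by fun_prop) hne
    · exact hF.continuousOn.mono sphere_subset_closedBall

lemma cauchy_H1 {h hs : ℂ → ℂ} (hh : DifferentiableOn ℂ h (ball (0:ℂ) 1)) (hb : IsBoundaryFn h hs) (hfin : hardyNorm 1 h ≠ ⊤) (hi : Integrable hs circleMeasure) {z : ℂ}
    (hz : ‖z‖ < 1) :
    ∫ ζ, hs ζ / (1 - (starRingEnd ℂ) ζ * z) ∂circleMeasure = h z := by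
  have hik : ∀ k, Integrable (fun ζ => h (rad k * ζ)) circleMeasure := fun k =>
    cm_integrable (dil_cont hh (rad_mem k).1 (rad_mem k).2)
  have h2 : Filter.Tendsto (fun k => h (rad k * z)) Filter.atTop (nhds (h z)) := by
    have hc : ContinuousAt h z := (hh.differentiableAt (isOpen_ball.mem_nhds (by simpa using hz))).continuousAt
    apply hc.tendsto.comp
    have : Filter.Tendsto rad Filter.atTop (nhds 1) := rad_tend.mono_right nhdsWithin_le_nhds
    have := ((Complex.continuous_ofReal.tendsto _).comp this).mul_const z
    simpa using this
  refine tendsto_nhds_unique ?_ h2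
  rw [tendsto_iff_norm_sub_tendsto_zero]
  have hL := (L1_conv hh hb hfin hi).const_mul (1 - ‖z‖)⁻¹
  rw [mul_zero] at hL
  refine squeeze_zero (fun _ => norm_nonneg _) (fun k => ?_) hL
  rw [← cauchy_dil (dil_analytic hh (rad_mem k).1 (rad_mem k).2) hz,
    ← integral_sub (div_den_integrable hz (hik k)) (div_den_integrable hz hi), ← integral_const_mul]
  apply norm_integral_le_of_norm_le (((hik k).sub hi).norm.const_mul _)
  filter_upwards [cm_ae_norm] with ζ hζ
  rw [← sub_div, norm_div, div_eq_inv_mul]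
  have := den_le (z := z) hζ
  have : ‖1 - (starRingEnd ℂ) ζ * z‖⁻¹ ≤ (1 - ‖z‖)⁻¹ := inv_anti₀ (by linarith) this
  exact mul_le_mul_of_nonneg_right this (norm_nonneg _)

end H1


noncomputable def gbd (f : ℂ → ℂ) (α : ℕ → ℝ) : ℂ → ℂ := fun z =>
  ∑' n, ((ee α n : ℝ) : ℂ) * fejSum f n z

noncomputable def wt (α : ℕ → ℝ) (M : ℝ) (n : ℕ) : ℝ := ((n:ℝ) + 1) * ee α n * (5 * M)

noncomputable def Phi (α : ℕ → ℝ) (M : ℝ) (ζ η : ℂ) : ℝ≥0∞ :=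
  ∑' n, ENNReal.ofReal (wt α M n * logKer (dl n) ζ η)

noncomputable def Cker (α : ℕ → ℝ) (M : ℝ) : ℝ≥0∞ :=
  ∑' n : ℕ, ENNReal.ofReal (wt α M n * (2 * Real.log ((n:ℝ) + 2)))

lemma wt_nonneg {α : ℕ → ℝ} (hα : GoodSeq α) {M : ℝ} (hM0 : 0 ≤ M) (n : ℕ) : 0 ≤ wt α M n := by
  unfold wt
  have := hα.ee_nonneg n
  positivity

lemma Cker_ne_top {α : ℕ → ℝ} (hα : GoodSeq α) {M : ℝ} : Cker α M ≠ ⊤ := by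
  have h := hα.summ_log.mul_left (10 * M)
  have h2 : Summable (fun n : ℕ => wt α M n * (2 * Real.log ((n:ℝ) + 2))) := by
    refine h.congr fun n => ?_
    unfold wt; ring
  exact h2.tsum_ofReal_ne_top

lemma Phi_meas (α : ℕ → ℝ) (M : ℝ) : Measurable (fun p : ℂ × ℂ => Phi α M p.1 p.2) := by
  unfold Phi
  refine Measurable.ennreal_tsum fun n => ?_
  have := (logKer_cont (dl_pos n)).measurable
  exact (this.const_mul _).ennreal_ofReal

lemma Phi_meas_left (α : ℕ → ℝ) (M : ℝ) (η : ℂ) : Measurable (fun ζ : ℂ => Phi α M ζ η) := by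
  unfold Phi
  refine Measurable.ennreal_tsum fun n => ?_
  have h1 : Continuous (fun ζ : ℂ => logKer (dl n) ζ η) :=
    (logKer_cont (dl_pos n)).comp (by fun_prop : Continuous fun ζ : ℂ => (ζ, η))
  exact (h1.measurable.const_mul _).ennreal_ofReal

lemma Phi_comm (α : ℕ → ℝ) (M : ℝ) (ζ η : ℂ) : Phi α M ζ η = Phi α M η ζ := by
  unfold Phi
  simp only [logKer_comm _ ζ η]

lemma Phi_meas_swap (α : ℕ → ℝ) (M : ℝ) : Measurable (fun p : ℂ × ℂ => Phi α M p.2 p.1) := by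
  have h : (fun p : ℂ × ℂ => Phi α M p.2 p.1) = fun p : ℂ × ℂ => Phi α M p.1 p.2 :=
    funext fun p => Phi_comm α M p.2 p.1
  rw [h]
  exact Phi_meas α M

lemma Phi_lintegral {α : ℕ → ℝ} (hα : GoodSeq α) {M : ℝ} (hM0 : 0 ≤ M) {η : ℂ} (hη : ‖η‖ = 1) :
    ∫⁻ ζ, Phi α M ζ η ∂circleMeasure ≤ Cker α M := by
  have hm : ∀ n, Measurable (fun ζ : ℂ => ENNReal.ofReal (logKer (dl n) ζ η)) := by
    intro n
    have h1 : Continuous (fun ζ : ℂ => logKer (dl n) ζ η) :=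
      (logKer_cont (dl_pos n)).comp (by fun_prop : Continuous fun ζ : ℂ => (ζ, η))
    exact h1.measurable.ennreal_ofReal
  unfold Phi Cker
  simp only [ENNReal.ofReal_mul (wt_nonneg hα hM0 _)]
  rw [lintegral_tsum (fun n => ((hm n).const_mul _).aemeasurable)]
  refine ENNReal.tsum_le_tsum fun n => ?_
  rw [lintegral_const_mul _ (hm n)]
  gcongr
  exact logKer_lintegral n hη

section

lemma g_term {α : ℕ → ℝ} (hα : GoodSeq α) {f : ℂ → ℂ}
    (hf : DifferentiableOn ℂ f (ball (0:ℂ) 1)) {M : ℝ}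
    (hM : ∀ z ∈ ball (0:ℂ) 1, ‖f z‖ ≤ M) (n : ℕ) {z : ℂ} (hz : ‖z‖ ≤ 1) :
    ‖((ee α n : ℝ) : ℂ) * fejSum f n z‖ ≤ M * (((n:ℝ) + 1) * ee α n) := by
  have h1 := fejSum_bound hf hM n hz
  have h2 := hα.ee_nonneg n
  rw [norm_mul, Complex.norm_real, Real.norm_of_nonneg h2]
  nlinarith

lemma g_summ {α : ℕ → ℝ} (hα : GoodSeq α) {f : ℂ → ℂ}
    (hf : DifferentiableOn ℂ f (ball (0:ℂ) 1)) {M : ℝ}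
    (hM : ∀ z ∈ ball (0:ℂ) 1, ‖f z‖ ≤ M) {z : ℂ} (hz : ‖z‖ ≤ 1) : Summable (fun n => ((ee α n : ℝ) : ℂ) * fejSum f n z) :=
  Summable.of_norm_bounded (hα.summ_ee.mul_left M) fun n => g_term hα hf hM n hz

lemma g_bound {α : ℕ → ℝ} (hα : GoodSeq α) {f : ℂ → ℂ}
    (hf : DifferentiableOn ℂ f (ball (0:ℂ) 1)) {M : ℝ}
    (hM : ∀ z ∈ ball (0:ℂ) 1, ‖f z‖ ≤ M) {z : ℂ} (hz : ‖z‖ ≤ 1) :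
    ‖gbd f α z‖ ≤ ∑' n : ℕ, M * (((n:ℝ) + 1) * ee α n) :=
  tsum_of_norm_bounded (hα.summ_ee.mul_left M).hasSum fun n => g_term hα hf hM n hz

lemma g_cont {α : ℕ → ℝ} (hα : GoodSeq α) {f : ℂ → ℂ}
    (hf : DifferentiableOn ℂ f (ball (0:ℂ) 1)) {M : ℝ}
    (hM : ∀ z ∈ ball (0:ℂ) 1, ‖f z‖ ≤ M) : ContinuousOn (gbd f α) (closedBall 0 1) := by
  refine continuousOn_tsum (fun n => ?_) (hα.summ_ee.mul_left M) (fun n z hz => ?_)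
  · exact (continuous_const.mul (fejSum_cont f n)).continuousOn
  · exact g_term hα hf hM n (by simpa using hz)

lemma g_diff {α : ℕ → ℝ} (hα : GoodSeq α) {f : ℂ → ℂ}
    (hf : DifferentiableOn ℂ f (ball (0:ℂ) 1)) {M : ℝ}
    (hM : ∀ z ∈ ball (0:ℂ) 1, ‖f z‖ ≤ M) : DifferentiableOn ℂ (gbd f α) (ball 0 1) := by
  refine differentiableOn_tsum_of_summable_norm (hα.summ_ee.mul_left M) (fun n => ?_) isOpen_ball
    (fun n z hz => ?_)
  · apply Differentiable.differentiableOn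
    unfold fejSum taylorPartial
    fun_prop
  · exact g_term hα hf hM n (by simpa using (ball_subset_closedBall hz))

lemma g_ker {α : ℕ → ℝ} (hα : GoodSeq α) {f : ℂ → ℂ}
    (hf : DifferentiableOn ℂ f (ball (0:ℂ) 1)) {M : ℝ}
    (hM : ∀ z ∈ ball (0:ℂ) 1, ‖f z‖ ≤ M) {ζ η : ℂ} {r : ℝ} (hζ : ‖ζ‖ = 1) (hη : ‖η‖ = 1) (h0 : 0 ≤ r) (h1 : r ≤ 1) :
    ENNReal.ofReal (‖gbd f α ζ - gbd f α (r * η)‖ / ‖ζ - r * η‖) ≤ Phi α M ζ η := by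
  have hM0 : 0 ≤ M := (norm_nonneg _).trans (hM 0 (by simp))
  have hrη : ‖(r:ℂ) * η‖ ≤ 1 := by
    rw [norm_mul, hη, Complex.norm_real, Real.norm_of_nonneg h0]; linarith
  rcases eq_or_lt_of_le (norm_nonneg (ζ - r * η)) with hd | hd
  · rw [← hd]; simp
  rw [ENNReal.ofReal_div_of_pos hd]
  apply ENNReal.div_le_of_le_mul
  have e1 : gbd f α ζ - gbd f α (r * η)
      = ∑' n, ((ee α n : ℝ) : ℂ) * (fejSum f n ζ - fejSum f n (r * η)) := by
    unfold gbd
    rw [← (g_summ hα hf hM hζ.le).tsum_sub (g_summ hα hf hM hrη)]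
    congr 1; ext n; ring
  rw [e1, ofReal_norm]
  unfold Phi
  rw [← ENNReal.tsum_mul_right]
  refine enorm_tsum_le_tsum_enorm.trans (ENNReal.tsum_le_tsum fun n => ?_)
  have hk := logKer_nonneg (dl_pos n) ζ η
  rw [← ENNReal.ofReal_mul (mul_nonneg (wt_nonneg hα hM0 n) hk), ← ofReal_norm]
  apply ENNReal.ofReal_le_ofReal
  have h2 := hα.ee_nonneg n
  rw [norm_mul, Complex.norm_real, Real.norm_of_nonneg h2]
  have h3 := fejSum_ker hf hM n hζ hη h0 h1
  calc _ ≤ ee α n * ((n + 1) * (5 * M * logKer (dl n) ζ η) * ‖ζ - r * η‖) := by gcongr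
    _ = _ := by unfold wt; ring

lemma den_eq {z ζ : ℂ} (hζ : ‖ζ‖ = 1) : ‖1 - (starRingEnd ℂ) ζ * z‖ = ‖ζ - z‖ := by
  have h3 : ζ * (starRingEnd ℂ) ζ = 1 := by
    rw [Complex.mul_conj, Complex.normSq_eq_norm_sq, hζ]; simp
  have h4 : ζ * (1 - (starRingEnd ℂ) ζ * z) = ζ - z := by
    linear_combination -z * h3
  rw [← h4, norm_mul, hζ, one_mul]

lemma toep_bd {α : ℕ → ℝ} (hα : GoodSeq α) {f : ℂ → ℂ}
    (hf : DifferentiableOn ℂ f (ball (0:ℂ) 1)) {M : ℝ}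
    (hM : ∀ z ∈ ball (0:ℂ) 1, ‖f z‖ ≤ M) {h hs : ℂ → ℂ} (hh : DifferentiableOn ℂ h (ball (0:ℂ) 1))
    (hb : IsBoundaryFn h hs) (hfin : hardyNorm 1 h ≠ ⊤) (hi : Integrable hs circleMeasure)
    {η : ℂ} {r : ℝ} (hη : ‖η‖ = 1) (h0 : 0 ≤ r) (h1 : r < 1) :
    ENNReal.ofReal ‖toeplitz (gbd f α) hs (r * η)‖ ≤
      ENNReal.ofReal (∑' n : ℕ, M * (((n:ℝ) + 1) * ee α n)) * ENNReal.ofReal ‖h (r * η)‖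
        + ∫⁻ ζ, Phi α M ζ η * ENNReal.ofReal ‖hs ζ‖ ∂circleMeasure := by
  set z : ℂ := r * η with hz
  have hz1 : ‖z‖ < 1 := by
    rw [hz, norm_mul, hη, Complex.norm_real, Real.norm_of_nonneg h0]; linarith
  set g := gbd f α with hg
  set G := ∑' n : ℕ, M * (((n:ℝ) + 1) * ee α n) with hG
  have hgc : ContinuousOn (fun ζ => (starRingEnd ℂ) (g ζ)) (sphere (0:ℂ) 1) :=
    Complex.continuous_conj.comp_continuousOn ((g_cont hα hf hM).mono sphere_subset_closedBall)
  have i1 : Integrable (fun ζ => (starRingEnd ℂ) (g ζ) * hs ζ) circleMeasure := by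
    refine hi.bdd_mul (c := G) (cm_aesm hgc) ?_
    filter_upwards [cm_ae_norm] with ζ hζ
    rw [RCLike.norm_conj]
    exact g_bound hα hf hM hζ.le
  have i2 := div_den_integrable hz1 i1
  have i3 := div_den_integrable hz1 hi
  have e1 : toeplitz g hs z = (starRingEnd ℂ) (g z) * h z
      + ∫ ζ, (starRingEnd ℂ) (g ζ - g z) * hs ζ / (1 - (starRingEnd ℂ) ζ * z) ∂circleMeasure := by
    rw [← cauchy_H1 hh hb hfin hi hz1, ← integral_const_mul,
      ← integral_add (i3.const_mul _)]
    · unfold toeplitz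
      congr 1; ext ζ
      rw [map_sub]; ring
    · refine (i2.sub (i3.const_mul ((starRingEnd ℂ) (g z)))).congr
        (Filter.Eventually.of_forall fun ζ => ?_)
      simp only [Pi.sub_apply, map_sub]; ring
  rw [e1]
  refine (ENNReal.ofReal_le_ofReal (norm_add_le _ _)).trans ?_
  rw [ENNReal.ofReal_add (norm_nonneg _) (norm_nonneg _)]
  gcongr ?_ + ?_
  · rw [norm_mul, RCLike.norm_conj, ENNReal.ofReal_mul (norm_nonneg _)]
    gcongr
    exact g_bound hα hf hM hz1.le
  · rw [ofReal_norm]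
    refine (enorm_integral_le_lintegral_enorm _).trans ?_
    apply lintegral_mono_ae
    filter_upwards [cm_ae_norm] with ζ hζ
    rw [← ofReal_norm, norm_div, norm_mul, RCLike.norm_conj, den_eq hζ, mul_div_right_comm,
      ENNReal.ofReal_mul (by positivity)]
    gcongr
    exact g_ker hα hf hM hζ hη h0 h1.le

lemma hardyNorm_le_eSup {h : ℂ → ℂ} : hardyNorm 1 h ≤ eSupAbs h := by
  unfold hardyNorm
  refine iSup₂_le fun r hr => ?_
  calc ∫⁻ ζ, ENNReal.ofReal (‖h (r * ζ)‖ ^ (1:ℝ)) ∂circleMeasure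
      ≤ ∫⁻ ζ, eSupAbs h ∂circleMeasure := by
        apply lintegral_mono_ae
        filter_upwards [cm_ae_norm] with ζ hζ
        rw [Real.rpow_one]
        exact le_iSup₂ (f := fun z (_ : z ∈ ball (0:ℂ) 1) => ENNReal.ofReal ‖h z‖) _
          (rad_map hr.1 hr.2 hζ.le)
    _ = eSupAbs h := by simp

lemma bd_le_eSup {h hs : ℂ → ℂ} (hb : IsBoundaryFn h hs) :
    ∀ᵐ ζ ∂circleMeasure, ENNReal.ofReal ‖hs ζ‖ ≤ eSupAbs h := by
  filter_upwards [bd_tend hb, cm_ae_norm] with ζ hζ h1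
  refine le_of_tendsto' ((ENNReal.continuous_ofReal.tendsto _).comp hζ.norm) fun k => ?_
  exact le_iSup₂ (f := fun z (_ : z ∈ ball (0:ℂ) 1) => ENNReal.ofReal ‖h z‖) _
    (rad_map (rad_mem k).1 (rad_mem k).2 h1.le)

lemma toep_H1 {α : ℕ → ℝ} (hα : GoodSeq α) {f : ℂ → ℂ}
    (hf : DifferentiableOn ℂ f (ball (0:ℂ) 1)) {M : ℝ}
    (hM : ∀ z ∈ ball (0:ℂ) 1, ‖f z‖ ≤ M) {h hs : ℂ → ℂ} (hh : DifferentiableOn ℂ h (ball (0:ℂ) 1))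
    (hb : IsBoundaryFn h hs) (hfin : hardyNorm 1 h ≠ ⊤) (hi : Integrable hs circleMeasure) :
    hardyNorm 1 (toeplitz (gbd f α) hs) ≤
      (ENNReal.ofReal (∑' n : ℕ, M * (((n:ℝ) + 1) * ee α n)) + Cker α M) * hardyNorm 1 h := by
  have hM0 : 0 ≤ M := (norm_nonneg _).trans (hM 0 (by simp))
  set G := ENNReal.ofReal (∑' n : ℕ, M * (((n:ℝ) + 1) * ee α n)) with hG
  have hsm : AEMeasurable (fun ζ => ENNReal.ofReal ‖hs ζ‖) circleMeasure :=
    hi.1.norm.aemeasurable.ennreal_ofReal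
  conv_lhs => unfold hardyNorm
  refine iSup₂_le fun r hr => ?_
  have hhm : AEMeasurable (fun η => ENNReal.ofReal ‖h (r * η)‖) circleMeasure :=
    (cm_aesm (dil_cont hh hr.1 hr.2)).norm.aemeasurable.ennreal_ofReal
  have hle : ∫⁻ η, ENNReal.ofReal ‖h (r * η)‖ ∂circleMeasure ≤ hardyNorm 1 h := by
    refine le_trans (le_of_eq ?_) (le_iSup₂ (f := fun r (_ : r ∈ Set.Ioo (0 : ℝ) 1) =>
      ∫⁻ ζ, ENNReal.ofReal (‖h (↑r * ζ)‖ ^ (1:ℝ)) ∂circleMeasure) r hr)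
    simp only [Real.rpow_one]
  simp only [Real.rpow_one]
  calc ∫⁻ η, ENNReal.ofReal ‖toeplitz (gbd f α) hs (r * η)‖ ∂circleMeasure
      ≤ ∫⁻ η, (G * ENNReal.ofReal ‖h (r * η)‖
        + ∫⁻ ζ, Phi α M ζ η * ENNReal.ofReal ‖hs ζ‖ ∂circleMeasure) ∂circleMeasure := by
        apply lintegral_mono_ae
        filter_upwards [cm_ae_norm] with η hη
        exact toep_bd hα hf hM hh hb hfin hi hη hr.1.le hr.2
    _ = G * ∫⁻ η, ENNReal.ofReal ‖h (r * η)‖ ∂circleMeasure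
        + ∫⁻ η, ∫⁻ ζ, Phi α M ζ η * ENNReal.ofReal ‖hs ζ‖ ∂circleMeasure ∂circleMeasure := by
        rw [lintegral_add_left' (hhm.const_mul _), lintegral_const_mul'' _ hhm]
    _ = G * ∫⁻ η, ENNReal.ofReal ‖h (r * η)‖ ∂circleMeasure
        + ∫⁻ ζ, ∫⁻ η, Phi α M ζ η * ENNReal.ofReal ‖hs ζ‖ ∂circleMeasure ∂circleMeasure := by
        congr 1
        apply lintegral_lintegral_swap
        have h1 : Measurable (fun p : ℂ × ℂ => Phi α M p.2 p.1) :=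
          Phi_meas_swap α M
        exact h1.aemeasurable.mul hsm.comp_snd
    _ ≤ G * hardyNorm 1 h + ∫⁻ ζ, Cker α M * ENNReal.ofReal ‖hs ζ‖ ∂circleMeasure := by
        gcongr ?_ + ?_
        · gcongr
        · apply lintegral_mono_ae
          filter_upwards [cm_ae_norm] with ζ hζ
          simp only [Phi_comm α M ζ]
          rw [lintegral_mul_const _ (Phi_meas_left α M ζ)]
          gcongr
          exact Phi_lintegral hα hM0 hζ
    _ ≤ G * hardyNorm 1 h + Cker α M * hardyNorm 1 h := by
        rw [lintegral_const_mul'' _ hsm]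
        gcongr
        exact bd_fatou hh hb
    _ = _ := by rw [add_mul]

lemma toep_Hinf {α : ℕ → ℝ} (hα : GoodSeq α) {f : ℂ → ℂ}
    (hf : DifferentiableOn ℂ f (ball (0:ℂ) 1)) {M : ℝ}
    (hM : ∀ z ∈ ball (0:ℂ) 1, ‖f z‖ ≤ M) {h hs : ℂ → ℂ} (hh : DifferentiableOn ℂ h (ball (0:ℂ) 1))
    (hb : IsBoundaryFn h hs) (hfin : eSupAbs h ≠ ⊤) :
    eSupAbs (toeplitz (gbd f α) hs) ≤
      (ENNReal.ofReal (∑' n : ℕ, M * (((n:ℝ) + 1) * ee α n)) + Cker α M) * eSupAbs h := by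
  have hM0 : 0 ≤ M := (norm_nonneg _).trans (hM 0 (by simp))
  set G := ENNReal.ofReal (∑' n : ℕ, M * (((n:ℝ) + 1) * ee α n)) with hG
  have hbd := bd_le_eSup hb
  have hi : Integrable hs circleMeasure := by
    refine (integrable_const (eSupAbs h).toReal).mono' (bd_aesm hh hb) ?_
    filter_upwards [hbd] with ζ hζ
    exact (ENNReal.ofReal_le_iff_le_toReal hfin).1 hζ
  have hfin1 : hardyNorm 1 h ≠ ⊤ := ne_top_of_le_ne_top hfin hardyNorm_le_eSup
  conv_lhs => unfold eSupAbs
  refine iSup₂_le fun z hz => ?_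
  have hz1 : ‖z‖ < 1 := by simpa using hz
  have hzr : z = ((‖z‖ : ℝ) : ℂ) * exp (arg z * I) := (Complex.norm_mul_exp_arg_mul_I z).symm
  have hη : ‖exp (arg z * I)‖ = 1 := Complex.norm_exp_ofReal_mul_I _
  have h1 := toep_bd hα hf hM hh hb hfin1 hi hη (norm_nonneg z) hz1
  rw [← hzr] at h1
  refine h1.trans ?_
  rw [add_mul]
  gcongr ?_ + ?_
  · gcongr
    exact le_iSup₂ (f := fun z (_ : z ∈ ball (0:ℂ) 1) => ENNReal.ofReal ‖h z‖) z hz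
  · calc _ ≤ ∫⁻ ζ, Phi α M ζ (exp (arg z * I)) * eSupAbs h ∂circleMeasure := by
          apply lintegral_mono_ae
          filter_upwards [hbd] with ζ hζ
          gcongr
      _ ≤ _ := by
          rw [lintegral_mul_const _ (Phi_meas_left α M _)]
          gcongr
          exact Phi_lintegral hα hM0 hη

lemma main_aux {α : ℕ → ℝ} (hα : GoodSeq α) {f : ℂ → ℂ}
    (hf : DifferentiableOn ℂ f (ball (0:ℂ) 1)) {M : ℝ}
    (hM : ∀ z ∈ ball (0:ℂ) 1, ‖f z‖ ≤ M) :
    IsBoundaryFn (seqConv f α) (gbd f α) ∧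
    DifferentiableOn ℂ (seqConv f α) (ball (0:ℂ) 1) ∧
    eSupAbs (seqConv f α) ≠ ⊤ ∧ Lam (gbd f α) ≠ ⊤ := by
  have hM0 : 0 ≤ M := (norm_nonneg _).trans (hM 0 (by simp))
  have heq : EqOn (seqConv f α) (gbd f α) (ball 0 1) := fun z hz => seqConv_eq hα hf hM hz
  refine ⟨?_, (g_diff hα hf hM).congr heq, ?_, ?_⟩
  · unfold IsBoundaryFn
    filter_upwards [cm_ae_norm] with ζ hζ
    have h1 : Filter.Tendsto (fun r : ℝ => (r:ℂ) * ζ) (nhdsWithin 1 (Iio 1))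
        (nhdsWithin ζ (closedBall 0 1)) := by
      apply tendsto_nhdsWithin_of_tendsto_nhds_of_eventually_within
      · have : Filter.Tendsto (fun r : ℝ => (r:ℂ) * ζ) (nhds 1) (nhds (((1:ℝ):ℂ) * ζ)) :=
          Continuous.tendsto (by fun_prop) 1
        rw [Complex.ofReal_one, one_mul] at this
        exact this.mono_left nhdsWithin_le_nhds
      · filter_upwards [Ioo_mem_nhdsLT (zero_lt_one' ℝ)] with r hr
        exact ball_subset_closedBall (rad_map hr.1 hr.2 hζ.le)
    have h2 : Filter.Tendsto (gbd f α) (nhdsWithin ζ (closedBall 0 1)) (nhds (gbd f α ζ)) :=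
      g_cont hα hf hM ζ (by simp [hζ])
    refine (h2.comp h1).congr' ?_
    filter_upwards [Ioo_mem_nhdsLT (zero_lt_one' ℝ)] with r hr
    exact (heq (rad_map hr.1 hr.2 hζ.le)).symm
  · refine ne_top_of_le_ne_top (ENNReal.ofReal_ne_top
      (r := ∑' n : ℕ, M * (((n:ℝ) + 1) * ee α n))) (iSup₂_le fun z hz => ?_)
    rw [heq hz]
    exact ENNReal.ofReal_le_ofReal (g_bound hα hf hM (by simpa using ball_subset_closedBall hz))
  · refine ne_top_of_le_ne_top (Cker_ne_top hα (M := M)) ?_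
    unfold Lam
    refine essSup_le_of_ae_le _ ?_
    filter_upwards [cm_ae_norm] with η hη
    refine le_trans ?_ (Phi_lintegral hα hM0 hη)
    apply lintegral_mono_ae
    filter_upwards [cm_ae_norm] with ζ hζ
    have := g_ker hα hf hM hζ hη zero_le_one le_rfl
    simpa using this

end

theorem final_aux (ε : ℝ) (hε : 0 < ε) (f : ℂ → ℂ)
    (hf : DifferentiableOn ℂ f (Metric.ball (0 : ℂ) 1))
    (hfb : eSupAbs f ≠ ⊤) :
    ∃ gs : ℂ → ℂ,
      IsBoundaryFn (seqConv f (alp ε)) gs ∧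
      DifferentiableOn ℂ (seqConv f (alp ε)) (Metric.ball (0 : ℂ) 1) ∧
      eSupAbs (seqConv f (alp ε)) ≠ ⊤ ∧
      Lam gs ≠ ⊤ ∧
      ∃ C : ℝ≥0∞, C ≠ ⊤ ∧
        (∀ h hs : ℂ → ℂ,
          DifferentiableOn ℂ h (Metric.ball (0 : ℂ) 1) →
          hardyNorm 1 h ≠ ⊤ →
          IsBoundaryFn h hs →
          Integrable hs circleMeasure →
          hardyNorm 1 (toeplitz gs hs) ≤ C * hardyNorm 1 h) ∧
        (∀ h hs : ℂ → ℂ,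
          DifferentiableOn ℂ h (Metric.ball (0 : ℂ) 1) →
          eSupAbs h ≠ ⊤ →
          IsBoundaryFn h hs →
          eSupAbs (toeplitz gs hs) ≤ C * eSupAbs h) := by
  have hα := alp_good hε
  have hM : ∀ z ∈ ball (0:ℂ) 1, ‖f z‖ ≤ (eSupAbs f).toReal := by
    intro z hz
    rw [← ENNReal.ofReal_le_iff_le_toReal hfb]
    exact le_iSup₂ (f := fun z (_ : z ∈ ball (0:ℂ) 1) => ENNReal.ofReal ‖f z‖) z hz
  obtain ⟨a1, a2, a3, a4⟩ := main_aux hα hf hM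
  exact ⟨gbd f (alp ε), a1, a2, a3, a4, _,
    ENNReal.add_ne_top.2 ⟨ENNReal.ofReal_ne_top, Cker_ne_top hα⟩,
    fun h hs b1 b2 b3 b4 => toep_H1 hα hf hM b1 b3 b2 b4,
    fun h hs b1 b2 b3 => toep_Hinf hα hf hM b1 b3 b2⟩

/-- **Theorem 3, third sequence.** For `ε > 0` and `α_n = 1/(log(n+2)·(log log(n+3))^{1+ε})`, for every `f ∈ H^∞` the function `f*α` belongs to `𝔑` and the Toeplitz operator `T_{f*α}` is bounded on `H^1` and on `H^∞`. -/
theorem theorem3_loglog_sequence (ε : ℝ) (hε : 0 < ε) (f : ℂ → ℂ)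
    (hf : DifferentiableOn ℂ f (Metric.ball (0 : ℂ) 1))
    (hfb : eSupAbs f ≠ ⊤) :
    ∃ gs : ℂ → ℂ,
      IsBoundaryFn (seqConv f (fun n : ℕ => 1 / (Real.log ((n : ℝ) + 2) * Real.log (Real.log ((n : ℝ) + 3)) ^ (1 + ε)))) gs ∧
      DifferentiableOn ℂ (seqConv f (fun n : ℕ => 1 / (Real.log ((n : ℝ) + 2) * Real.log (Real.log ((n : ℝ) + 3)) ^ (1 + ε)))) (Metric.ball (0 : ℂ) 1) ∧
      eSupAbs (seqConv f (fun n : ℕ => 1 / (Real.log ((n : ℝ) + 2) * Real.log (Real.log ((n : ℝ) + 3)) ^ (1 + ε)))) ≠ ⊤ ∧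
      Lam gs ≠ ⊤ ∧
      ∃ C : ℝ≥0∞, C ≠ ⊤ ∧
        (∀ h hs : ℂ → ℂ,
          DifferentiableOn ℂ h (Metric.ball (0 : ℂ) 1) →
          hardyNorm 1 h ≠ ⊤ →
          IsBoundaryFn h hs →
          Integrable hs circleMeasure →
          hardyNorm 1 (toeplitz gs hs) ≤ C * hardyNorm 1 h) ∧
        (∀ h hs : ℂ → ℂ,
          DifferentiableOn ℂ h (Metric.ball (0 : ℂ) 1) →
          eSupAbs h ≠ ⊤ →
          IsBoundaryFn h hs →
          eSupAbs (toeplitz gs hs) ≤ C * eSupAbs h) := by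
  exact final_aux ε hε f hf hfb
end

section
/- Let f be a bounded analytic function on the open unit disk 𝔻 with Taylor coefficients f̂(n), and let α = (α_n)_{n≥0} be a monotone decreasing sequence of positive real numbers with nondecreasing successive differences (α_n − 2α_{n+1} + α_{n+2} ≥ 0 for all n) such that ∑_{n≥0} α_n/(n+1) < ∞. Then for every z ∈ 𝔻, (f*α)(z) = ∑_{n≥0} (α_n − 2α_{n+1} + α_{n+2})(n+1) σ_n(f)(z), where the series on the right converges. -/
open MeasureTheory Complex Metric Set
open scoped ENNReal

lemma aux_abel (α : ℕ → ℝ) (c S T : ℕ → ℂ) (hS0 : S 0 = 0) (hT0 : T 0 = 0)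
    (hS : ∀ n, S (n + 1) = S n + c n) (hT : ∀ n, T (n + 1) = T n + S (n + 1)) (N : ℕ) :
    ∑ n ∈ Finset.range N, ((α n - 2 * α (n + 1) + α (n + 2) : ℝ) : ℂ) * T (n + 1)
      = ∑ n ∈ Finset.range N, (α n : ℂ) * c n - α N * S N - ((α N - α (N + 1) : ℝ) : ℂ) * T N := by
  induction N with
  | zero => simp [hS0, hT0]
  | succ N ih =>
    rw [Finset.sum_range_succ, Finset.sum_range_succ, ih, hT N, hS N]
    push_cast
    ring

lemma aux_real (α : ℕ → ℝ) (N : ℕ) :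
    ∑ n ∈ Finset.range N, (α n - 2 * α (n + 1) + α (n + 2)) * ((n : ℝ) + 1)
      = α 0 - α N - N * (α N - α (N + 1)) := by
  induction N with
  | zero => simp
  | succ N ih =>
    rw [Finset.sum_range_succ, ih]
    push_cast
    ring

lemma aux_tendsto (α : ℕ → ℝ) (hpos : ∀ n, 0 < α n) (hdec : ∀ n, α (n + 1) ≤ α n)
    (hsum : Summable fun n => α n / ((n : ℝ) + 1)) :
    Filter.Tendsto α Filter.atTop (nhds 0) := by
  have hanti : Antitone α := antitone_nat_of_succ_le hdec
  have hb : BddBelow (Set.range α) := ⟨0, by rintro _ ⟨n, rfl⟩; exact (hpos n).le⟩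
  have ht := tendsto_atTop_ciInf hanti hb
  have h0 : 0 ≤ ⨅ i, α i := le_ciInf fun n => (hpos n).le
  rcases h0.eq_or_lt with h | h
  · rwa [← h] at ht
  · exfalso
    have h1 : Summable fun n : ℕ => (⨅ i, α i) * (1 / ((n : ℝ) + 1)) := by
      refine Summable.of_nonneg_of_le (fun n => by positivity) (fun n => ?_) hsum
      rw [mul_one_div]
      gcongr
      exact ciInf_le hb n
    rw [summable_mul_left_iff h.ne'] at h1
    have h2 := (summable_nat_add_iff (f := fun n : ℕ => 1 / (n : ℝ)) 1).1 (by simpa using h1)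
    exact Real.not_summable_one_div_natCast h2

lemma aux_nd (α : ℕ → ℝ) (hpos : ∀ n, 0 < α n) (hdec : ∀ n, α (n + 1) ≤ α n)
    (hconc : ∀ n, 0 ≤ α n - 2 * α (n + 1) + α (n + 2))
    (h0 : Filter.Tendsto α Filter.atTop (nhds 0)) :
    Filter.Tendsto (fun N : ℕ => (N : ℝ) * (α N - α (N + 1))) Filter.atTop (nhds 0) := by
  have hd : Antitone fun n => α n - α (n + 1) :=
    antitone_nat_of_succ_le fun n => by have := hconc n; show α (n+1) - α (n+1+1) ≤ _; linarith
  have key : ∀ m k : ℕ, (k : ℝ) * (α (m + k) - α (m + k + 1)) ≤ α m - α (m + k) := by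
    intro m k
    have h1 : ∑ i ∈ Finset.range k, (α (m + i) - α (m + (i + 1))) = α m - α (m + k) :=
      Finset.sum_range_sub' (fun i => α (m + i)) k
    rw [← h1, ← nsmul_eq_mul]
    have := Finset.card_nsmul_le_sum (Finset.range k) (fun i => α (m + i) - α (m + (i + 1)))
      (α (m + k) - α (m + k + 1))
      (fun i hi => hd (by have := Finset.mem_range.1 hi; omega : m + i ≤ m + k))
    simpa using this
  have hlim : Filter.Tendsto (fun N : ℕ => 2 * α (N / 2)) Filter.atTop (nhds 0) := by
    simpa using (h0.comp (Nat.tendsto_div_const_atTop (by norm_num : (2 : ℕ) ≠ 0))).const_mul 2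
  refine squeeze_zero (fun N => mul_nonneg (Nat.cast_nonneg _) (sub_nonneg.2 (hdec N)))
    (fun N => ?_) hlim
  have h := key (N / 2) (N - N / 2)
  rw [Nat.add_sub_cancel' (Nat.div_le_self N 2)] at h
  have h2 : (N : ℝ) ≤ 2 * ((N - N / 2 : ℕ) : ℝ) := by
    exact_mod_cast (by omega : N ≤ 2 * (N - N / 2))
  have h3 := mul_le_mul_of_nonneg_right h2 (sub_nonneg.2 (hdec N))
  have := hpos N
  linarith

/-- For `f` bounded analytic on `𝔻` and `α` a monotone decreasing, concave sequence of positive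
numbers with `∑ α_n/(n+1) < ∞`, for every `z ∈ 𝔻` the series
`∑ (α_n - 2α_{n+1} + α_{n+2})(n+1) σ_n(f)(z)` converges to `(f*α)(z)`. -/
theorem conv_eq_cesaro_series (f : ℂ → ℂ)
    (hf : DifferentiableOn ℂ f (Metric.ball (0 : ℂ) 1))
    (hfb : eSupAbs f ≠ ⊤)
    (α : ℕ → ℝ)
    (hpos : ∀ n, 0 < α n)
    (hdec : ∀ n, α (n + 1) ≤ α n)
    (hconc : ∀ n, 0 ≤ α n - 2 * α (n + 1) + α (n + 2))
    (hsum : Summable fun n => α n / ((n : ℝ) + 1))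
    (z : ℂ) (hz : z ∈ Metric.ball (0 : ℂ) 1) :
    HasSum
      (fun n : ℕ => ((α n - 2 * α (n + 1) + α (n + 2) : ℝ) : ℂ) * ((n : ℂ) + 1) * cesaro f n z)
      (seqConv f α z) := by
  have hc : Summable fun n : ℕ => taylorCoeff f n * z ^ n := by
    have h := (Complex.hasSum_taylorSeries_on_ball (c := 0) (r := 1) (by simpa using hf)
      (by simpa using hz)).summable
    refine h.congr fun n => ?_
    simp [taylorCoeff, smul_eq_mul]
    ring
  set c : ℕ → ℂ := fun n => taylorCoeff f n * z ^ n with hcdef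
  have hcn : Summable fun n => ‖c n‖ := hc.norm
  set C := ∑' n, ‖c n‖ with hC
  set S : ℕ → ℂ := fun n => ∑ k ∈ Finset.range n, c k with hSdef
  set T : ℕ → ℂ := fun n => ∑ k ∈ Finset.range n, S (k + 1) with hTdef
  have hSb : ∀ n, ‖S n‖ ≤ C := fun n =>
    (norm_sum_le _ _).trans (hcn.sum_le_tsum _ fun _ _ => norm_nonneg _)
  have hTb : ∀ n : ℕ, ‖T n‖ ≤ n * C := fun n =>
    (norm_sum_le_of_le _ fun k _ => hSb (k + 1)).trans (by simp)
  have hC0 : 0 ≤ C := tsum_nonneg fun _ => norm_nonneg _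
  have hterm : (fun n : ℕ => ((α n - 2 * α (n + 1) + α (n + 2) : ℝ) : ℂ) * ((n : ℂ) + 1)
      * cesaro f n z) = fun n => ((α n - 2 * α (n + 1) + α (n + 2) : ℝ) : ℂ) * T (n + 1) := by
    funext n
    have hn : (n : ℂ) + 1 ≠ 0 := Nat.cast_add_one_ne_zero n
    rw [cesaro, mul_assoc, mul_inv_cancel_left₀ hn]
    rfl
  rw [hterm]
  have h0 := aux_tendsto α hpos hdec hsum
  have hnd := aux_nd α hpos hdec hconc h0
  have hS2 : Summable fun n : ℕ => (α n - 2 * α (n + 1) + α (n + 2)) * ((n : ℝ) + 1) := by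
    refine summable_of_sum_range_le (c := α 0)
      (fun n => mul_nonneg (hconc n) (by positivity)) fun N => ?_
    rw [aux_real]
    have h1 : 0 ≤ (N : ℝ) * (α N - α (N + 1)) :=
      mul_nonneg (Nat.cast_nonneg _) (sub_nonneg.2 (hdec N))
    have := hpos N
    linarith
  have hsumm : Summable fun n => ((α n - 2 * α (n + 1) + α (n + 2) : ℝ) : ℂ) * T (n + 1) := by
    refine Summable.of_norm_bounded (hS2.mul_right C) fun n => ?_
    rw [norm_mul, Complex.norm_real, Real.norm_of_nonneg (hconc n), mul_assoc]
    refine mul_le_mul_of_nonneg_left ?_ (hconc n)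
    simpa using hTb (n + 1)
  rw [hsumm.hasSum_iff_tendsto_nat]
  simp_rw [aux_abel α c S T (by simp [hSdef]) (by simp [hTdef])
    (fun n => Finset.sum_range_succ _ _) (fun n => Finset.sum_range_succ _ _)]
  have hanti : Antitone α := antitone_nat_of_succ_le hdec
  have hsa : Summable fun n => (α n : ℂ) * c n := by
    refine Summable.of_norm_bounded (hcn.mul_left (α 0)) fun n => ?_
    rw [norm_mul, Complex.norm_real, Real.norm_of_nonneg (hpos n).le]
    exact mul_le_mul_of_nonneg_right (hanti (Nat.zero_le n)) (norm_nonneg _)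
  have heq : seqConv f α z = ∑' n, (α n : ℂ) * c n := by
    rw [seqConv]
    refine tsum_congr fun n => ?_
    simp only [hcdef]
    ring
  have t1 := hsa.hasSum.tendsto_sum_nat
  have t2 : Filter.Tendsto (fun N => (α N : ℂ) * S N) Filter.atTop (nhds 0) := by
    refine squeeze_zero_norm (fun N => ?_) (by simpa using h0.mul_const C)
    rw [norm_mul, Complex.norm_real, Real.norm_of_nonneg (hpos N).le]
    exact mul_le_mul_of_nonneg_left (hSb N) (hpos N).le
  have t3 : Filter.Tendsto (fun N => ((α N - α (N + 1) : ℝ) : ℂ) * T N) Filter.atTop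
      (nhds 0) := by
    refine squeeze_zero_norm (fun N => ?_) (by simpa using hnd.mul_const C)
    rw [norm_mul, Complex.norm_real, Real.norm_of_nonneg (sub_nonneg.2 (hdec N))]
    have := mul_le_mul_of_nonneg_left (hTb N) (sub_nonneg.2 (hdec N))
    linarith
  rw [heq]
  simpa using (t1.sub t2).sub t3
end
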